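/- arXiv:math/0409295 — 8 statements merged into one kernel-verified Lean document; each statement's English description precedes it below -/
import Mathlib

section
/- With g, H, the grading g_j, p and n as in the context, the following are equivalent: (1) p is nice, i.e. there exists x ∈ g_1 with ⁅p, x⁆ = n; (2) there exists x ∈ g_1 such that ad(x) : g_j → g_{j+1} is surjective for every integer j ≥ 0; (3) there exists x ∈ g_1 such that ad(x) : g_j → g_{j+1} is surjective for every integer j > 0. -/
namespace GradedLie

open Polynomial Module

section PolynomialFamilies

variable {K V : Type*} [Field K] [AddCommGroup V] [Module K V]

/-- The value at the scalar `t` of a polynomial with endomorphism coefficients. -/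
noncomputable def evalEnd (P : (End K V)[X]) (t : K) : End K V :=
  P.eval (algebraMap K (End K V) t)

lemma evalEnd_mul (P Q : (End K V)[X]) (t : K) :
    evalEnd (P * Q) t = evalEnd P t * evalEnd Q t :=
  eval₂_mul_noncomm _ _ fun _ => (Algebra.commutes t _).symm

lemma evalEnd_pow (P : (End K V)[X]) (t : K) (k : ℕ) :
    evalEnd (P ^ k) t = evalEnd P t ^ k := by
  induction k with
  | zero => simp [evalEnd]
  | succ k ih => rw [pow_succ, evalEnd_mul, ih, pow_succ]

lemma evalEnd_C (A : End K V) (t : K) : evalEnd (C A) t = A := by simp [evalEnd]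

lemma evalEnd_linear (A B : End K V) (t : K) : evalEnd (C A + C B * X) t = A + t • B := by
  simp only [evalEnd, eval_add, eval_C, eval_mul_X]
  rw [← Algebra.commutes, ← Algebra.smul_def]

lemma evalEnd_zero (P : (End K V)[X]) : evalEnd P 0 = P.coeff 0 := by
  simp [evalEnd, coeff_zero_eq_eval_zero]

lemma evalEnd_eq_divX (P : (End K V)[X]) (t : K) :
    evalEnd P t = t • evalEnd P.divX t + P.coeff 0 := by
  conv_lhs => rw [← divX_mul_X_add P]
  simp only [evalEnd, eval_add, eval_C, eval_mul_X]
  rw [← Algebra.commutes, ← Algebra.smul_def]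

lemma exists_eval_eq_dual_evalEnd (P : (End K V)[X]) (f : Dual K V) (v : V) :
    ∃ p : K[X], ∀ t, f (evalEnd P t v) = p.eval t := by
  induction P using Polynomial.induction_on' with
  | add P Q hP hQ =>
    obtain ⟨p, hp⟩ := hP
    obtain ⟨q, hq⟩ := hQ
    refine ⟨p + q, fun t => ?_⟩
    rw [eval_add, ← hp, ← hq]
    simp [evalEnd]
  | monomial n a =>
    refine ⟨monomial n (f (a v)), fun t => ?_⟩
    rw [evalEnd, eval_monomial, eval_monomial, ← map_pow, ← Algebra.commutes,
      ← Algebra.smul_def]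
    simp [mul_comm]

/-- Linear independence of a polynomial family of vectors is an open condition. -/
lemma finite_not_linearIndependent {ι : Type*} [Fintype ι] (q : ι → K → V)
    (hq : ∀ i (f : Dual K V), ∃ p : K[X], ∀ t, f (q i t) = p.eval t)
    (h : LinearIndependent K fun i => q i 0) :
    {t | ¬ LinearIndependent K fun i => q i t}.Finite := by
  classical
  obtain ⟨g, hgl⟩ := (Fintype.linearCombination K fun i => q i 0).exists_leftInverse_of_injective
    (LinearMap.ker_eq_bot.2 (h.fintypeLinearCombination_injective))
  have hg (i : ι) : g (q i 0) = Pi.single i 1 := by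
    have := LinearMap.congr_fun hgl (Pi.single i 1)
    simpa [Fintype.linearCombination_apply_single] using this
  choose p hp using fun i j => hq i ((LinearMap.proj j).comp g)
  let M : Matrix ι ι K[X] := Matrix.of p
  have hM (t : K) : M.det.eval t = (Matrix.of fun i => g (q i t)).det := by
    rw [← coe_evalRingHom, RingHom.map_det]
    congr 1
    ext i j
    simpa [M] using (hp i j t).symm
  have hne : M.det ≠ 0 := by
    intro h0
    have h1 := hM 0
    have h2 : (Matrix.of fun i => g (q i 0)) = (1 : Matrix ι ι K) := by
      ext i j
      simp [hg, Matrix.one_apply, Pi.single_apply, eq_comm]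
    rw [h2, h0] at h1
    simp at h1
  refine (M.det.finite_setOfPred_isRoot hne).subset fun t ht => ?_
  by_contra hroot
  refine ht (LinearIndependent.of_comp g ?_)
  have hdet : (Matrix.of fun i => g (q i t)).det ≠ 0 := by rw [← hM]; exact hroot
  exact Matrix.linearIndependent_rows_of_det_ne_zero hdet

lemma card_le_finrank_range [FiniteDimensional K V] {ι : Type*} [Fintype ι] {v : ι → V}
    (hv : LinearIndependent K v) (A : End K V) (h : ∀ i, v i ∈ LinearMap.range A) :
    Fintype.card ι ≤ finrank K (LinearMap.range A) := by
  rw [← finrank_span_eq_card hv]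
  exact Submodule.finrank_mono (Submodule.span_le.2 (by rintro _ ⟨i, rfl⟩; exact h i))

lemma exists_linearIndependent_image [FiniteDimensional K V] (A : End K V) :
    ∃ u : Fin (finrank K (LinearMap.range A)) → V, LinearIndependent K (fun i => A (u i)) ∧
      Submodule.span K (Set.range fun i => A (u i)) = LinearMap.range A := by
  let b := finBasis K (LinearMap.range A)
  choose u hu using fun i => (b i).2
  have hb : (fun i => A (u i)) = (LinearMap.range A).subtype ∘ b := funext hu
  refine ⟨u, ?_, ?_⟩
  · rw [hb]
    exact b.linearIndependent.map' _ (Submodule.ker_subtype _)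
  · rw [hb, Set.range_comp, Submodule.span_image, b.span_eq, Submodule.map_subtype_top]

/-- The rank of a polynomial family of endomorphisms drops at finitely many parameters only. -/
lemma finite_finrank_lt [FiniteDimensional K V] (P : (End K V)[X]) :
    {t | finrank K (LinearMap.range (evalEnd P t)) <
      finrank K (LinearMap.range (evalEnd P 0))}.Finite := by
  obtain ⟨u, hu, -⟩ := exists_linearIndependent_image (evalEnd P 0)
  refine (finite_not_linearIndependent (fun i t => evalEnd P t (u i))
    (fun i f => exists_eval_eq_dual_evalEnd P f (u i)) hu).subset fun t ht hli => ?_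
  have := card_le_finrank_range hli (evalEnd P t) fun i => LinearMap.mem_range_self _ _
  rw [Fintype.card_fin] at this
  exact absurd ht (not_lt.2 this)

/-- If the rank of a polynomial family is maximal at `0`, the linear term maps the kernel of
the constant term into its range. -/
lemma coeff_one_mem_range [Infinite K] [FiniteDimensional K V] (P : (End K V)[X])
    (hmax : ∀ t, finrank K (LinearMap.range (evalEnd P t)) ≤
      finrank K (LinearMap.range (P.coeff 0))) (v : V) (hv : P.coeff 0 v = 0) :
    P.coeff 1 v ∈ LinearMap.range (P.coeff 0) := by
  by_contra hnot
  obtain ⟨u, hu, hspan⟩ := exists_linearIndependent_image (P.coeff 0)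
  let q : Option (Fin (finrank K (LinearMap.range (P.coeff 0)))) → K → V := fun o t =>
    o.casesOn' (evalEnd P.divX t v) fun i => evalEnd P t (u i)
  have hli : LinearIndependent K fun o => q o 0 := by
    refine linearIndependent_option'.2 ⟨?_, ?_⟩
    · simpa only [evalEnd_zero] using hu
    · simp only [evalEnd_zero]
      rwa [hspan, coeff_divX]
  have hfin := finite_not_linearIndependent q (by
    rintro (_ | i) f
    · exact exists_eval_eq_dual_evalEnd P.divX f v
    · exact exists_eval_eq_dual_evalEnd P f (u i)) hli
  obtain ⟨t, ht⟩ := (hfin.union (Set.finite_singleton (0 : K))).infinite_compl.nonempty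
  simp only [Set.mem_compl_iff, Set.mem_union, Set.mem_ofPred_eq, Set.mem_singleton_iff, not_or,
    not_not] at ht
  have hcard := card_le_finrank_range ht.1 (evalEnd P t) (by
    rintro (_ | i)
    · refine ⟨t⁻¹ • v, ?_⟩
      rw [map_smul, evalEnd_eq_divX]
      simp [hv, smul_smul, inv_mul_cancel₀ ht.2, q]
    · exact ⟨u i, rfl⟩)
  have := hmax t
  simp only [Fintype.card_option, Fintype.card_fin] at hcard
  omega

/-- For finitely many families of endomorphisms depending polynomially on a point of a subspace,
some point maximizes all the ranks simultaneously. -/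
lemma exists_forall_finrank_le [Infinite K] [FiniteDimensional K V] {E ι : Type*}
    [AddCommGroup E] [Module K E] [Fintype ι] (S : Submodule K E) (F : ι → E → End K V)
    (hF : ∀ i x z, ∃ P : (End K V)[X], ∀ t : K, evalEnd P t = F i (x + t • z)) :
    ∃ x ∈ S, ∀ y ∈ S, ∀ i,
      finrank K (LinearMap.range (F i y)) ≤ finrank K (LinearMap.range (F i x)) := by
  let r : ι → E → ℕ := fun i x => finrank K (LinearMap.range (F i x))
  let T : Set ℕ := {n | ∃ x ∈ S, ∑ i, r i x = n}
  have hne : T.Nonempty := ⟨_, 0, S.zero_mem, rfl⟩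
  have hbdd : BddAbove T := by
    refine ⟨∑ _i : ι, finrank K V, ?_⟩
    rintro _ ⟨x, -, rfl⟩
    exact Finset.sum_le_sum fun i _ => Submodule.finrank_le _
  obtain ⟨x, hx, hxT⟩ := Nat.sSup_mem hne hbdd
  refine ⟨x, hx, fun y hy i => ?_⟩
  have hline : ∀ a b : E, ∀ j, {t : K | r j (a + t • (b - a)) < r j a}.Finite := by
    intro a b j
    obtain ⟨P, hP⟩ := hF j a (b - a)
    have h0 := hP 0
    rw [zero_smul, add_zero] at h0
    refine (finite_finrank_lt P).subset fun t ht => ?_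
    rw [Set.mem_ofPred_eq, hP, h0]
    exact ht
  have h1 : (⋃ j, {t : K | r j (x + t • (y - x)) < r j x}).Finite :=
    Set.finite_iUnion fun j => hline x y j
  have h2 : ((fun t : K => 1 - t) ⁻¹' {t : K | r i (y + t • (x - y)) < r i y}).Finite :=
    (hline y x i).preimage (sub_right_injective.injOn)
  obtain ⟨t, ht⟩ := (h1.union h2).infinite_compl.nonempty
  simp only [Set.mem_compl_iff, Set.mem_union, Set.mem_iUnion, Set.mem_preimage,
    Set.mem_ofPred_eq, not_or, not_exists, not_lt] at ht
  have hpt : y + (1 - t) • (x - y) = x + t • (y - x) := by module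
  rw [hpt] at ht
  have hmem : x + t • (y - x) ∈ S := S.add_mem hx (S.smul_mem t (S.sub_mem hy hx))
  have hsum : ∑ j, r j (x + t • (y - x)) ≤ ∑ j, r j x := by
    rw [hxT]
    exact le_csSup hbdd ⟨_, hmem, rfl⟩
  have heq : r i (x + t • (y - x)) = r i x := by
    have := (Finset.sum_eq_sum_iff_of_le fun j _ => ht.1 j).1
      (le_antisymm (Finset.sum_le_sum fun j _ => ht.1 j) hsum)
    exact (this i (Finset.mem_univ i)).symm
  exact ht.2.trans heq.le

end PolynomialFamilies

section TangentSpace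

/-- The derivative at `0` of `t ↦ (X + t Z) ^ k`. -/
def powDeriv {R : Type*} [Ring R] (X Z : R) : ℕ → R
  | 0 => 0
  | k + 1 => powDeriv X Z k * X + X ^ k * Z

lemma powDeriv_add_commutator {R : Type*} [Ring R] (X Z M : R) (k : ℕ) :
    powDeriv X (Z + (M * X - X * M)) k = powDeriv X Z k + (M * X ^ k - X ^ k * M) := by
  induction k with
  | zero => simp [powDeriv]
  | succ k ih =>
    simp only [powDeriv, ih, pow_succ]
    noncomm_ring

lemma coeff_linear_pow {R : Type*} [Ring R] (A B : R) (k : ℕ) :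
    ((C A + C B * X) ^ k).coeff 0 = A ^ k ∧ ((C A + C B * X) ^ k).coeff 1 = powDeriv A B k := by
  induction k with
  | zero => simp [powDeriv, coeff_one]
  | succ k ih =>
    rw [pow_succ, mul_coeff_zero, mul_coeff_one, ih.1, ih.2]
    simp [powDeriv, pow_succ, add_comm]

/-- If `Z` is tangent at the nilpotent endomorphism `X` to the locus where all the ranks of powers
are constant, then `Z` is orthogonal to the centralizer of `X` for the trace form. -/
lemma trace_mul_eq_zero {K : Type*} [Field K] (N : ℕ) :
    ∀ {V : Type*} [AddCommGroup V] [Module K V] [FiniteDimensional K V],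
      finrank K V ≤ N → ∀ X A Z : End K V, IsNilpotent X → Commute A X →
      (∀ k ≤ N, ∀ v, (X ^ k) v = 0 → powDeriv X Z k v ∈ LinearMap.range (X ^ k)) →
      LinearMap.trace K V (A * Z) = 0 := by
  induction N with
  | zero =>
    intro V _ _ _ hV X A Z _ _ _
    have : Subsingleton V := finrank_zero_iff.1 (Nat.le_zero.1 hV)
    rw [Subsingleton.elim (A * Z) 0, map_zero]
  | succ N ih =>
    intro V _ _ _ hV X A Z hX hAX h
    set W := LinearMap.range X with hWdef
    have hW : finrank K W ≤ N := by
      by_contra hlt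
      have htop : W = ⊤ := Submodule.eq_top_of_finrank_eq
        (le_antisymm (Submodule.finrank_le _) (by omega))
      obtain ⟨m, hm⟩ := hX
      have hsurj : Function.Surjective (X ^ m) := by
        rw [Module.End.coe_pow]
        exact (LinearMap.range_eq_top.1 htop).iterate m
      have : Subsingleton V := ⟨fun a b => by
        obtain ⟨a, rfl⟩ := hsurj a
        obtain ⟨b, rfl⟩ := hsurj b
        simp [hm]⟩
      have : finrank K W = 0 := finrank_zero_of_subsingleton
      omega
    obtain ⟨s₀, hs₀⟩ := X.rangeRestrict.exists_rightInverse_of_surjective X.range_rangeRestrict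
    obtain ⟨s, hs⟩ := s₀.exists_extend
    have hXs (v : V) : X (s (X v)) = X v := by
      have h1 : s (X v) = s₀ ⟨X v, LinearMap.mem_range_self X v⟩ :=
        LinearMap.congr_fun hs ⟨X v, LinearMap.mem_range_self X v⟩
      rw [h1]
      exact congrArg Subtype.val (LinearMap.congr_fun hs₀ ⟨X v, LinearMap.mem_range_self X v⟩)
    let M : End K V := -(Z * s)
    let Z' : End K V := Z + (M * X - X * M)
    have hZ'mem (v : V) : Z' v ∈ W := by
      have h1 : Z (v - s (X v)) ∈ W := by
        simpa only [powDeriv, pow_zero, pow_one, zero_mul, one_mul, zero_add] using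
          h 1 (by omega) (v - s (X v)) (by simp [hXs])
      have h2 : Z' v = Z (v - s (X v)) - X (M v) := by
        simp [Z', M]
        abel
      rw [h2]
      exact W.sub_mem h1 (LinearMap.mem_range_self X _)
    have hZ' : ∀ k ≤ N + 1, ∀ v, (X ^ k) v = 0 → powDeriv X Z' k v ∈ LinearMap.range (X ^ k) := by
      intro k hk v hv
      rw [powDeriv_add_commutator]
      simp only [LinearMap.add_apply, LinearMap.sub_apply, Module.End.mul_apply, hv, map_zero,
        zero_sub]
      exact Submodule.add_mem _ (h k hk v hv) (Submodule.neg_mem _ (LinearMap.mem_range_self _ _))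
    have htr : LinearMap.trace K V (A * Z') = LinearMap.trace K V (A * Z) := by
      have h1 : LinearMap.trace K V (A * (M * X)) = LinearMap.trace K V (A * (X * M)) := by
        rw [← mul_assoc, LinearMap.trace_mul_comm, ← mul_assoc, ← mul_assoc, hAX.eq]
      simp only [Z', mul_add, mul_sub, map_add, map_sub, h1, sub_self, add_zero]
    have hXW : ∀ v ∈ W, X v ∈ W := fun v _ => LinearMap.mem_range_self X v
    have hAW : ∀ v ∈ W, A v ∈ W := by
      rintro _ ⟨v, rfl⟩
      exact ⟨A v, (LinearMap.congr_fun hAX.eq v).symm⟩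
    have hZW : ∀ v ∈ W, Z' v ∈ W := fun v _ => hZ'mem v
    have hpowW (k : ℕ) (v : W) : (((X.restrict hXW) ^ k) v : V) = (X ^ k) v := by
      induction k generalizing v with
      | zero => rfl
      | succ k ihk => rw [pow_succ, pow_succ, Module.End.mul_apply, Module.End.mul_apply, ihk]; rfl
    have hderW (k : ℕ) (v : W) :
        (powDeriv (X.restrict hXW) (Z'.restrict hZW) k v : V) = powDeriv X Z' k v := by
      induction k generalizing v with
      | zero => rfl
      | succ k ihk =>
        simp only [powDeriv, LinearMap.add_apply, Module.End.mul_apply, Submodule.coe_add, ihk,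
          hpowW]
        rfl
    rw [← htr, ← LinearMap.trace_restrict_eq_of_forall_mem W (A * Z')
      fun v => hAW _ (hZ'mem v)]
    refine ih hW (X.restrict hXW) (A.restrict hAW) (Z'.restrict hZW) ?_ ?_ ?_
    · obtain ⟨m, hm⟩ := hX
      refine ⟨m, LinearMap.ext fun v => Subtype.ext ?_⟩
      rw [hpowW, hm]
      rfl
    · exact LinearMap.ext fun v => Subtype.ext (LinearMap.congr_fun hAX.eq v)
    · rintro k hk ⟨_, u, rfl⟩ hv
      have hv' : (X ^ (k + 1)) u = 0 := by
        have := congrArg Subtype.val hv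
        rw [hpowW] at this
        rwa [pow_succ]
      obtain ⟨a, ha⟩ := hZ' (k + 1) (by omega) u hv'
      obtain ⟨b, hb⟩ := hZ'mem u
      refine ⟨⟨X a - X b, W.sub_mem (LinearMap.mem_range_self X a)
        (LinearMap.mem_range_self X b)⟩, Subtype.ext ?_⟩
      rw [hpowW, hderW]
      simp only [powDeriv, LinearMap.add_apply, Module.End.mul_apply, pow_succ] at ha
      simp only [map_sub, ha, hb]
      abel

end TangentSpace

section Grading

variable {K L : Type*} [Field K] [LieRing L] [LieAlgebra K L]

variable (K) in
/-- The eigenspace of `ad H` for the integer eigenvalue `j`. -/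
noncomputable def grade (H : L) (j : ℤ) : Submodule K L :=
  End.eigenspace (LieAlgebra.ad K L H) (j : K)

lemma mem_grade {H : L} {j : ℤ} {x : L} : x ∈ grade K H j ↔ ⁅H, x⁆ = (j : K) • x :=
  End.mem_eigenspace_iff

lemma lie_mem_grade {H : L} {i j : ℤ} {x y : L} (hx : x ∈ grade K H i) (hy : y ∈ grade K H j) :
    ⁅x, y⁆ ∈ grade K H (i + j) := by
  rw [mem_grade] at *
  rw [leibniz_lie, hx, hy, smul_lie, lie_smul, ← add_smul, Int.cast_add]

lemma lie_mem_grade_add_one {H : L} {j : ℤ} {x y : L} (hx : x ∈ grade K H 1)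
    (hy : y ∈ grade K H j) : ⁅x, y⁆ ∈ grade K H (j + 1) :=
  add_comm 1 j ▸ lie_mem_grade hx hy

lemma ad_lie (x y : L) : LieAlgebra.ad K L ⁅x, y⁆ =
    LieAlgebra.ad K L x * LieAlgebra.ad K L y - LieAlgebra.ad K L y * LieAlgebra.ad K L x := by
  ext z
  simp

lemma isNilpotent_ad_of_mem_grade_one [CharZero K] [FiniteDimensional K L] {H x : L}
    (hx : x ∈ grade K H 1) : IsNilpotent (LieAlgebra.ad K L x) := by
  set a := LieAlgebra.ad K L H
  set b := LieAlgebra.ad K L x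
  have hab : a * b - b * a = b := by
    have h1 : LieAlgebra.ad K L ⁅H, x⁆ = b := by rw [mem_grade.1 hx]; simp [b]
    rwa [ad_lie] at h1
  have hpow (k : ℕ) : a * b ^ k - b ^ k * a = (k : K) • b ^ k := by
    induction k with
    | zero => simp
    | succ k ih =>
      have : a * b ^ (k + 1) - b ^ (k + 1) * a =
          (a * b ^ k - b ^ k * a) * b + b ^ k * (a * b - b * a) := by
        rw [pow_succ]; noncomm_ring
      rw [this, ih, hab, smul_mul_assoc, ← pow_succ, Nat.cast_succ, add_smul, one_smul]
  by_contra hnil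
  let T : End K (End K L) := LinearMap.mulLeft K a - LinearMap.mulRight K a
  have hT (k : ℕ) : T.HasEigenvalue (k : K) :=
    End.hasEigenvalue_of_hasEigenvector (x := b ^ k)
      ⟨End.mem_eigenspace_iff.2 (hpow k), fun h => hnil ⟨k, h⟩⟩
  exact Set.infinite_of_injective_forall_mem (Nat.cast_injective (R := K)) hT
    T.finite_hasEigenvalue

lemma killingForm_eq_zero [CharZero K] [FiniteDimensional K L] {H : L} {i j : ℤ} (hij : i + j ≠ 0)
    {x y : L} (hx : x ∈ grade K H i) (hy : y ∈ grade K H j) : killingForm K L x y = 0 := by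
  have h := LieModule.traceForm_apply_lie_apply' K L L H x y
  rw [mem_grade.1 hx, mem_grade.1 hy, map_smul, map_smul, LinearMap.smul_apply, smul_eq_mul,
    smul_eq_mul, eq_neg_iff_add_eq_zero, ← add_mul, ← Int.cast_add] at h
  exact (mul_eq_zero.1 h).resolve_left (Int.cast_ne_zero.2 hij)

lemma eq_zero_of_forall_killingForm [CharZero K] [FiniteDimensional K L] [LieAlgebra.IsKilling K L]
    {H : L} (htop : ⨆ j, grade K H j = ⊤) {w : L}
    (h : ∀ j, ∀ y ∈ grade K H j, killingForm K L w y = 0) : w = 0 := by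
  have hker : (⊤ : Submodule K L) ≤ LinearMap.ker (killingForm K L w) := by
    rw [← htop]
    exact iSup_le h
  have : w ∈ LinearMap.ker (killingForm K L) :=
    LinearMap.mem_ker.2 (LinearMap.ext fun y => hker (Submodule.mem_top (x := y)))
  rwa [LieAlgebra.IsKilling.ker_killingForm_eq_bot, Submodule.mem_bot] at this

/-- There is an element of degree one whose adjoint action is injective in degree `-1`; moreover it
may be chosen generic for the rank of `ad x ∘ Q`, where `Q` is any given endomorphism. -/
lemma exists_injective_of_generic [CharZero K] [FiniteDimensional K L] [LieAlgebra.IsKilling K L]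
    {H : L} (htop : ⨆ j, grade K H j = ⊤) (Q : End K L) :
    ∃ x ∈ grade K H 1, (∀ w ∈ grade K H (-1), ⁅x, w⁆ = 0 → w = 0) ∧
      ∀ y ∈ grade K H 1, finrank K (LinearMap.range (LieAlgebra.ad K L y * Q)) ≤
        finrank K (LinearMap.range (LieAlgebra.ad K L x * Q)) := by
  have : Infinite K := Infinite.of_injective _ (Nat.cast_injective (R := K))
  let n := finrank K L
  have hlin (x z : L) (t : K) : evalEnd (C (LieAlgebra.ad K L x) + C (LieAlgebra.ad K L z) * X) t =
      LieAlgebra.ad K L (x + t • z) := by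
    rw [evalEnd_linear, map_add, map_smul]
  obtain ⟨x, hx, hmax⟩ := exists_forall_finrank_le (grade K H 1)
    (fun (o : Option (Fin (n + 1))) y => o.casesOn' (LieAlgebra.ad K L y * Q)
      fun k => LieAlgebra.ad K L y ^ (k : ℕ)) (by
    rintro (_ | k) x z
    · refine ⟨(C (LieAlgebra.ad K L x) + C (LieAlgebra.ad K L z) * X) * C Q, fun t => ?_⟩
      rw [evalEnd_mul, hlin, evalEnd_C]
      rfl
    · refine ⟨(C (LieAlgebra.ad K L x) + C (LieAlgebra.ad K L z) * X) ^ (k : ℕ), fun t => ?_⟩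
      rw [evalEnd_pow, hlin]
      rfl)
  refine ⟨x, hx, fun w hw hxw => eq_zero_of_forall_killingForm htop fun j z hz => ?_,
    fun y hy => hmax y hy none⟩
  rcases ne_or_eq j 1 with hj | rfl
  · exact killingForm_eq_zero (by omega) hw hz
  rw [LieModule.traceForm_apply_apply]
  refine trace_mul_eq_zero n le_rfl (LieAlgebra.ad K L x) (LieAlgebra.ad K L w)
    (LieAlgebra.ad K L z) (isNilpotent_ad_of_mem_grade_one hx) ?_ fun k hk v hv => ?_
  · have h1 : LieAlgebra.ad K L ⁅x, w⁆ = 0 := by rw [hxw, map_zero]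
    rw [ad_lie, sub_eq_zero] at h1
    exact h1.symm
  · have hc := coeff_linear_pow (LieAlgebra.ad K L x) (LieAlgebra.ad K L z) k
    have h := coeff_one_mem_range
      ((C (LieAlgebra.ad K L x) + C (LieAlgebra.ad K L z) * X) ^ k) (fun t => ?_) v
      (by rwa [hc.1])
    · rwa [hc.1, hc.2] at h
    · rw [evalEnd_pow, hlin, hc.1]
      exact hmax (x + t • z) (Submodule.add_mem _ hx (Submodule.smul_mem _ t hz))
        (some ⟨k, Nat.lt_succ_of_le hk⟩)

lemma grade_sup_iSup_ne (H : L) (htop : ⨆ j, grade K H j = ⊤) (j : ℤ) :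
    grade K H j ⊔ ⨆ (i) (_ : i ≠ j), grade K H i = ⊤ :=
  top_le_iff.1 (htop ▸ iSup_le fun i => by
    rcases eq_or_ne i j with rfl | hi
    · exact le_sup_left
    · exact le_sup_of_le_right (le_iSup₂_of_le i hi le_rfl))

lemma disjoint_grade_iSup_ne [CharZero K] (H : L) (j : ℤ) :
    Disjoint (grade K H j) (⨆ (i) (_ : i ≠ j), grade K H i) :=
  ((End.eigenspaces_iSupIndep (LieAlgebra.ad K L H)).comp (Int.cast_injective (α := K))) j

lemma mem_map_grade_of_lie_mem [CharZero K] {H : L} (htop : ⨆ j, grade K H j = ⊤) {x : L}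
    (hx : x ∈ grade K H 1) {j : ℤ} {u : L} (hu : ⁅x, u⁆ ∈ grade K H (j + 1)) :
    ⁅x, u⁆ ∈ (grade K H j).map (LieAlgebra.ad K L x) := by
  obtain ⟨a, ha, b, hb, rfl⟩ : ∃ a ∈ grade K H j, ∃ b ∈ ⨆ (i) (_ : i ≠ j), grade K H i,
      a + b = u := Submodule.mem_sup.1 (grade_sup_iSup_ne H htop j ▸ Submodule.mem_top)
  have hxb : ⁅x, b⁆ ∈ ⨆ (i) (_ : i ≠ j + 1), grade K H i := by
    have hle : (⨆ (i) (_ : i ≠ j), grade K H i) ≤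
        (⨆ (i) (_ : i ≠ j + 1), grade K H i).comap (LieAlgebra.ad K L x) :=
      iSup₂_le fun i hi c hc => Submodule.mem_iSup_of_mem (i + 1) <|
        Submodule.mem_iSup_of_mem (by omega) (lie_mem_grade_add_one hx hc)
    exact hle hb
  have hxb' : ⁅x, b⁆ ∈ grade K H (j + 1) := by
    have := Submodule.sub_mem _ hu (lie_mem_grade_add_one hx ha)
    rwa [lie_add, add_sub_cancel_left] at this
  rw [lie_add, Submodule.disjoint_def.1 (disjoint_grade_iSup_ne H (j + 1)) _ hxb' hxb, add_zero]
  exact ⟨a, ha, rfl⟩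

lemma map_ad_grade_le {H x : L} (hx : x ∈ grade K H 1) (j : ℤ) :
    (grade K H j).map (LieAlgebra.ad K L x) ≤ grade K H (j + 1) :=
  Submodule.map_le_iff_le_comap.2 fun _ hy => lie_mem_grade_add_one hx hy

lemma map_ad_iSup_grade_le {H x : L} (hx : x ∈ grade K H 1) (m : ℤ) :
    (⨆ (j) (_ : m ≤ j), grade K H j).map (LieAlgebra.ad K L x) ≤
      ⨆ (j) (_ : m + 1 ≤ j), grade K H j := by
  simp only [Submodule.map_iSup]
  exact iSup₂_le fun j hj => (map_ad_grade_le hx j).trans (le_iSup₂_of_le (j + 1) (by omega) le_rfl)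

/-- Surjectivity of `ad x` on all homogeneous components from degree `m` on is surjectivity on
their sum. -/
lemma map_ad_iSup_grade_eq_iff [CharZero K] {H x : L} (htop : ⨆ j, grade K H j = ⊤)
    (hx : x ∈ grade K H 1) (m : ℤ) :
    (⨆ (j) (_ : m ≤ j), grade K H j).map (LieAlgebra.ad K L x) =
        ⨆ (j) (_ : m + 1 ≤ j), grade K H j ↔
      ∀ j, m ≤ j → (grade K H j).map (LieAlgebra.ad K L x) = grade K H (j + 1) := by
  refine ⟨fun h j hj => le_antisymm (map_ad_grade_le hx j) fun z hz => ?_, fun h =>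
    le_antisymm (map_ad_iSup_grade_le hx m) (iSup₂_le fun j hj => ?_)⟩
  · have hz' : z ∈ ⨆ (i) (_ : m + 1 ≤ i), grade K H i :=
      Submodule.mem_iSup_of_mem (j + 1) (Submodule.mem_iSup_of_mem (by omega) hz)
    rw [← h] at hz'
    obtain ⟨u, -, rfl⟩ := hz'
    exact mem_map_grade_of_lie_mem htop hx hz
  · have := h (j - 1) (by omega)
    rw [sub_add_cancel] at this
    rw [← this]
    exact Submodule.map_mono (le_iSup₂_of_le (j - 1) (by omega) le_rfl)

/-- If `ad x` is injective in degree `-1`, then it maps degree `0` onto degree `1`. -/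
lemma map_ad_grade_zero_eq [CharZero K] [FiniteDimensional K L] [LieAlgebra.IsKilling K L]
    {H x : L} (htop : ⨆ j, grade K H j = ⊤) (hx : x ∈ grade K H 1)
    (hinj : ∀ w ∈ grade K H (-1), ⁅x, w⁆ = 0 → w = 0) :
    (grade K H 0).map (LieAlgebra.ad K L x) = grade K H 1 := by
  set A := (grade K H 0).map (LieAlgebra.ad K L x)
  set B := ⨆ (i) (_ : i ≠ (1 : ℤ)), grade K H i
  have hA : A ≤ grade K H 1 := map_ad_grade_le hx 0
  have hAB : A ⊔ B = ⊤ := by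
    by_contra hne
    obtain ⟨f, hf, hker⟩ := (A ⊔ B).exists_le_ker_of_lt_top (lt_top_iff_ne_top.2 hne)
    have hfA : ∀ y ∈ A, f y = 0 := fun y hy => hker (Submodule.mem_sup_left hy)
    have hfB : ∀ j ≠ 1, ∀ y ∈ grade K H j, f y = 0 := fun j hj y hy =>
      hker (Submodule.mem_sup_right (Submodule.mem_iSup_of_mem j (Submodule.mem_iSup_of_mem hj hy)))
    obtain ⟨w, rfl⟩ : ∃ w, killingForm K L w = f :=
      ((killingForm K L).toDual (LieAlgebra.IsKilling.killingForm_nondegenerate K L)).surjective f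
    have hw : w ∈ grade K H (-1) := by
      rw [mem_grade, ← sub_eq_zero]
      refine eq_zero_of_forall_killingForm htop fun j y hy => ?_
      rw [map_sub, LinearMap.sub_apply, LieModule.traceForm_apply_lie_apply' K L L H w y,
        mem_grade.1 hy, map_smul, map_smul, LinearMap.smul_apply]
      rcases eq_or_ne j 1 with rfl | hj
      · simp
      · simp [hfB j hj y hy]
    refine hf ?_
    rw [hinj w hw, map_zero]
    refine eq_zero_of_forall_killingForm htop fun j y hy => ?_
    rw [LieModule.traceForm_apply_lie_apply' K L L x w y, neg_eq_zero]
    rcases eq_or_ne j 0 with rfl | hj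
    · exact hfA _ ⟨y, hy, rfl⟩
    · exact hfB (j + 1) (by omega) _ (lie_mem_grade_add_one hx hy)
  refine le_antisymm hA fun z hz => ?_
  obtain ⟨a, ha, b, hb, rfl⟩ := Submodule.mem_sup.1 (hAB ▸ Submodule.mem_top (x := z))
  have hb1 : b ∈ grade K H 1 := by
    have := Submodule.sub_mem _ hz (hA ha)
    rwa [add_sub_cancel_left] at this
  rw [Submodule.disjoint_def.1 (disjoint_grade_iSup_ne H 1) b hb1 hb, add_zero]
  exact ha

/-- If `ad y` is surjective in all positive degrees for some `y` of degree one, then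
`ad x` is surjective in all nonnegative degrees for some `x` of degree one. -/
lemma exists_map_ad_grade_eq [CharZero K] [FiniteDimensional K L] [LieAlgebra.IsKilling K L]
    {H y : L} (htop : ⨆ j, grade K H j = ⊤) (hy : y ∈ grade K H 1)
    (h : ∀ j, 0 < j → (grade K H j).map (LieAlgebra.ad K L y) = grade K H (j + 1)) :
    ∃ x ∈ grade K H 1,
      ∀ j, 0 ≤ j → (grade K H j).map (LieAlgebra.ad K L x) = grade K H (j + 1) := by
  set n := ⨆ (j) (_ : (1 : ℤ) ≤ j), grade K H j
  obtain ⟨q, hq⟩ := n.subtype.exists_leftInverse_of_injective n.ker_subtype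
  have hrange (x : L) : LinearMap.range (LieAlgebra.ad K L x * (n.subtype ∘ₗ q)) =
      n.map (LieAlgebra.ad K L x) := by
    have hq' : LinearMap.range q = ⊤ := LinearMap.range_eq_top.2 fun v =>
      ⟨v, LinearMap.congr_fun hq v⟩
    rw [Module.End.mul_eq_comp, LinearMap.range_comp, LinearMap.range_comp, hq',
      Submodule.map_subtype_top]
  obtain ⟨x, hx, hinj, hmax⟩ := exists_injective_of_generic htop (n.subtype ∘ₗ q)
  have hle := hmax y hy
  rw [hrange, hrange, (map_ad_iSup_grade_eq_iff htop hy 1).2 h] at hle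
  have hpos := (map_ad_iSup_grade_eq_iff htop hx 1).1
    (Submodule.eq_of_le_of_finrank_le (map_ad_iSup_grade_le hx 1) hle)
  refine ⟨x, hx, fun j hj => ?_⟩
  rcases hj.eq_or_lt with rfl | hj
  · simpa using map_ad_grade_zero_eq htop hx hinj
  · exact hpos j hj

end Grading

end GradedLie

/-- Let `L` be a finite-dimensional semisimple Lie algebra over `ℂ`, and
`H ∈ L` with `ad H` diagonalizable with integer eigenvalues; `g j` is the eigenspace of
`ad H` for the eigenvalue `j`, `p = ⨆_{j ≥ 0} g j` and `n = ⨆_{j > 0} g j`.  The following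
are equivalent: (1) `p` is nice, i.e. there is `x ∈ g 1` with `⁅p, x⁆ = n`; (2) there is
`x ∈ g 1` with `ad x : g j → g (j+1)` surjective for all `j ≥ 0`; (3) there is `x ∈ g 1`
with `ad x : g j → g (j+1)` surjective for all `j > 0`. -/
theorem statement0
    (L : Type*) [LieRing L] [LieAlgebra ℂ L] [FiniteDimensional ℂ L]
    [LieAlgebra.IsSemisimple ℂ L]
    (H : L)
    (g : ℤ → Submodule ℂ L)
    (hg : ∀ j : ℤ, g j = Module.End.eigenspace (LieAlgebra.ad ℂ L H) (j : ℂ))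
    (hgrade : ⨆ j : ℤ, g j = ⊤)
    (p n : Submodule ℂ L)
    (hp : p = ⨆ (j : ℤ) (_ : 0 ≤ j), g j)
    (hn : n = ⨆ (j : ℤ) (_ : 0 < j), g j) :
    List.TFAE
      [∃ x ∈ g 1, Submodule.map (LieAlgebra.ad ℂ L x) p = n,
       ∃ x ∈ g 1, ∀ j : ℤ, 0 ≤ j →
          Submodule.map (LieAlgebra.ad ℂ L x) (g j) = g (j + 1),
       ∃ x ∈ g 1, ∀ j : ℤ, 0 < j →
          Submodule.map (LieAlgebra.ad ℂ L x) (g j) = g (j + 1)] := by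
  obtain rfl : g = GradedLie.grade ℂ H := funext hg
  subst hp hn
  tfae_have 1 ↔ 2 := exists_congr fun x => and_congr_right fun hx =>
    GradedLie.map_ad_iSup_grade_eq_iff hgrade hx 0
  tfae_have 2 → 3 := fun ⟨x, hx, h⟩ => ⟨x, hx, fun j hj => h j hj.le⟩
  tfae_have 3 → 2 := fun ⟨_, hx, h⟩ => GradedLie.exists_map_ad_grade_eq hgrade hx h
  tfae_finish
end

section
/- With g, H, the grading g_j, p and n as in the context, p is nice (there exists x ∈ g_1 with ⁅p, x⁆ = n) if and only if there exists x ∈ g_1 such that ad(x) : g_{j−1} → g_j is injective for every integer j ≤ 0, i.e. ad(x) is injective on the sum ⊕_{j<0} g_j of the negatively graded pieces. -/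
theorem killingForm_lie_left (L : Type*) [LieRing L] [LieAlgebra ℂ L] (x y z : L) :
    killingForm ℂ L ⁅x, y⁆ z = - killingForm ℂ L y ⁅x, z⁆ := by
  rw [← lie_skew x y, map_neg, LinearMap.neg_apply, LieModule.traceForm_apply_lie_apply]

/-- Eigenspaces of `ad H` for eigenvalues not summing to zero are orthogonal for the
Killing form. -/
theorem killingForm_eq_zero_of_mem_eigenspace (L : Type*) [LieRing L] [LieAlgebra ℂ L] {H a b : L}
    {r s : ℂ} (ha : ⁅H, a⁆ = r • a) (hb : ⁅H, b⁆ = s • b) (h : r + s ≠ 0) :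
    killingForm ℂ L a b = 0 := by
  have key := killingForm_lie_left L H a b
  rw [ha, hb, map_smul, LinearMap.smul_apply, map_smul, smul_eq_mul, smul_eq_mul] at key
  have : (r + s) * killingForm ℂ L a b = 0 := by linear_combination key
  exact (mul_eq_zero.mp this).resolve_left h

/-- A family of submodules spanning the whole space can be tested componentwise. -/
theorem eq_zero_of_forall_mem_of_iSup_eq_top {L ι : Type*} [AddCommGroup L] [Module ℂ L]
    {g : ι → Submodule ℂ L} (hg : ⨆ j, g j = ⊤) (f : L →ₗ[ℂ] ℂ)
    (h : ∀ j, ∀ z ∈ g j, f z = 0) (z : L) : f z = 0 := by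
  have : ⨆ j, g j ≤ LinearMap.ker f := iSup_le fun j z hz ↦ h j z hz
  rw [hg] at this
  exact this (Submodule.mem_top (x := z))

/-- With `L`, `H`, the grading `g`, `p` and `n` as in the context,
`p` is nice (there exists `x ∈ g 1` with `⁅p, x⁆ = n`) if and only if there exists
`x ∈ g 1` such that `ad x : g (j-1) → g j` is injective for every integer `j ≤ 0`. -/
theorem statement1
    (L : Type*) [LieRing L] [LieAlgebra ℂ L] [FiniteDimensional ℂ L]
    [LieAlgebra.IsSemisimple ℂ L]
    (H : L)
    (g : ℤ → Submodule ℂ L)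
    (hg : ∀ j : ℤ, g j = Module.End.eigenspace (LieAlgebra.ad ℂ L H) (j : ℂ))
    (hgrade : ⨆ j : ℤ, g j = ⊤)
    (p n : Submodule ℂ L)
    (hp : p = ⨆ (j : ℤ) (_ : 0 ≤ j), g j)
    (hn : n = ⨆ (j : ℤ) (_ : 0 < j), g j) :
    (∃ x ∈ g 1, Submodule.map (LieAlgebra.ad ℂ L x) p = n) ↔
      (∃ x ∈ g 1, ∀ j : ℤ, j ≤ 0 → ∀ y ∈ g (j - 1), ⁅x, y⁆ = 0 → y = 0) := by
  have mem (j : ℤ) (a : L) : a ∈ g j ↔ ⁅H, a⁆ = (j : ℂ) • a := by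
    rw [hg, Module.End.mem_eigenspace_iff, LieAlgebra.ad_apply]
  have orth {i j : ℤ} (hij : i + j ≠ 0) {a b : L} (ha : a ∈ g i) (hb : b ∈ g j) :
      killingForm ℂ L a b = 0 :=
    killingForm_eq_zero_of_mem_eigenspace L ((mem i a).mp ha) ((mem j b).mp hb)
      (by exact_mod_cast hij)
  have lie_mem {i j : ℤ} {a b : L} (ha : a ∈ g i) (hb : b ∈ g j) : ⁅a, b⁆ ∈ g (i + j) := by
    rw [mem] at *
    rw [leibniz_lie, ha, hb, smul_lie, lie_smul, ← add_smul]
    push_cast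
    rfl
  have nondeg := LieAlgebra.IsKilling.killingForm_nondegenerate ℂ L
  have eq_zero {y : L} (h : ∀ j, ∀ z ∈ g j, killingForm ℂ L y z = 0) : y = 0 :=
    nondeg.1 y (eq_zero_of_forall_mem_of_iSup_eq_top hgrade _ h)
  refine exists_congr fun x ↦ and_congr_right fun hx ↦ ⟨fun hmap j hj y hy hxy ↦ ?_, fun hinj ↦ ?_⟩
  · refine eq_zero fun i z hz ↦ ?_
    by_cases hi : 0 < i
    · have hzn : z ∈ n := hn ▸ (le_iSup₂_of_le i hi le_rfl : g i ≤ _) hz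
      rw [← hmap] at hzn
      obtain ⟨w, -, rfl⟩ := hzn
      have key := killingForm_lie_left L x y w
      rw [hxy, map_zero, LinearMap.zero_apply] at key
      exact neg_eq_zero.mp key.symm
    · exact orth (by omega) hy hz
  · apply le_antisymm
    · rw [Submodule.map_le_iff_le_comap, hp]
      refine iSup₂_le fun j hj z hz ↦ ?_
      have hle : g (1 + j) ≤ n := hn ▸ le_iSup₂_of_le (1 + j) (by omega) le_rfl
      exact hle (lie_mem hx hz)
    · rw [hn]
      refine iSup₂_le fun j hj u hu ↦ ?_
      by_contra hu'
      obtain ⟨f, hfu, hf⟩ := Submodule.exists_le_ker_of_notMem hu'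
      obtain ⟨y, rfl⟩ := ((killingForm ℂ L).toDual nondeg).surjective f
      replace hf (w : L) (hw : w ∈ p) : killingForm ℂ L y ⁅x, w⁆ = 0 :=
        hf (Submodule.mem_map_of_mem hw)
      obtain ⟨a, ha, b, hb, rfl⟩ : ∃ a ∈ g (-j), ∃ b ∈ ⨆ (i : ℤ) (_ : i ≠ -j), g i, a + b = y := by
        rw [← Submodule.mem_sup]
        have hle : ⨆ i, g i ≤ g (-j) ⊔ ⨆ (i : ℤ) (_ : i ≠ -j), g i := iSup_le fun i ↦ by
          by_cases hi : i = -j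
          · exact hi ▸ le_sup_left
          · exact le_sup_of_le_right (le_iSup₂_of_le i hi le_rfl)
        exact hle (hgrade ▸ Submodule.mem_top)
      have hb' {v : L} (hv : v ∈ g j) : killingForm ℂ L b v = 0 := by
        have hle : ⨆ (i : ℤ) (_ : i ≠ -j), g i ≤ LinearMap.ker ((killingForm ℂ L).flip v) :=
          iSup₂_le fun i hi c hc ↦ orth (by omega) hc hv
        exact hle hb
      have hxa : ⁅x, a⁆ = 0 := by
        refine eq_zero fun i z hz ↦ ?_
        by_cases hi : i = j - 1
        · have hxz : ⁅x, z⁆ ∈ g j := by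
            have := lie_mem hx hz
            rwa [hi, add_sub_cancel] at this
          have hzp : z ∈ p := hp ▸ (le_iSup₂_of_le i (by omega) le_rfl : g i ≤ _) hz
          have key := hf z hzp
          rw [map_add, LinearMap.add_apply, hb' hxz, add_zero] at key
          rw [killingForm_lie_left, key, neg_zero]
        · exact orth (by omega) (lie_mem hx ha) hz
      have ha0 : a = 0 := hinj (-j + 1) (by omega) a (by rwa [add_sub_cancel_right]) hxa
      apply hfu
      change killingForm ℂ L (a + b) u = 0
      rw [ha0, zero_add, hb' hu]
end

section
/- With g, H, the grading g_j, p and n as in the context: if p is nice, then (i) dim_ℂ g_j ≥ dim_ℂ g_{j+1} for every integer j > 1, and (ii) if moreover n ≠ {0}, then dim_ℂ g_1 > dim_ℂ g_2. -/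
/-- `ad x` shifts the `ad H`-eigenvalue by one when `x` has eigenvalue one. -/
lemma lie_mem_eigenspace_ad_add_one {L : Type*} [LieRing L] [LieAlgebra ℂ L] {H x y : L} {j : ℤ}
    (hx : x ∈ Module.End.eigenspace (LieAlgebra.ad ℂ L H) ((1 : ℤ) : ℂ))
    (hy : y ∈ Module.End.eigenspace (LieAlgebra.ad ℂ L H) (j : ℂ)) :
    ⁅x, y⁆ ∈ Module.End.eigenspace (LieAlgebra.ad ℂ L H) ((j + 1 : ℤ) : ℂ) := by
  rw [Module.End.mem_eigenspace_iff, LieAlgebra.ad_apply] at *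
  rw [leibniz_lie, hx, hy, smul_lie, lie_smul, ← add_smul]
  push_cast
  rw [add_comm]

/-- If a map sends each member of a spanning family into the next member of the same independent
family, then an element of degree `j + 1` in its range is the image of an element of degree `j`. -/
lemma iSupIndep.exists_mem_map_eq {V : Type*} [AddCommGroup V] [Module ℂ V]
    {g : ℤ → Submodule ℂ V} (hind : iSupIndep g) (htop : ⨆ j, g j = ⊤) {f : V →ₗ[ℂ] V}
    (hf : ∀ j, ∀ y ∈ g j, f y ∈ g (j + 1)) {j : ℤ} {z : V} (hz : f z ∈ g (j + 1)) :
    ∃ a ∈ g j, f a = f z := by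
  have hz' : z ∈ g j ⊔ ⨆ i, ⨆ (_ : i ≠ j), g i := by
    rw [← iSup_split_single, htop]
    trivial
  obtain ⟨a, ha, b, hb, rfl⟩ := Submodule.mem_sup.mp hz'
  refine ⟨a, ha, ?_⟩
  have hle : (⨆ i, ⨆ (_ : i ≠ j), g i) ≤ (⨆ i, ⨆ (_ : i ≠ j + 1), g i).comap f :=
    iSup₂_le fun i hi y hy ↦
      (le_iSup₂_of_le (f := fun i (_ : i ≠ j + 1) ↦ g i) (i + 1) (by lia) le_rfl) (hf i y hy)
  have hb1 : f b ∈ g (j + 1) := by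
    simpa using (g (j + 1)).sub_mem hz (hf j a ha)
  rw [map_add, Submodule.disjoint_def.mp (hind (j + 1)) _ hb1 (hle hb), add_zero]

/-- With `L`, `H`, the grading `g`, `p` and `n` as in the context:
if `p` is nice then (i) `dim g j ≥ dim g (j+1)` for every integer `j > 1`, and
(ii) if moreover `n ≠ 0`, then `dim g 1 > dim g 2`. -/
theorem statement2
    (L : Type*) [LieRing L] [LieAlgebra ℂ L] [FiniteDimensional ℂ L]
    [LieAlgebra.IsSemisimple ℂ L]
    (H : L)
    (g : ℤ → Submodule ℂ L)
    (hg : ∀ j : ℤ, g j = Module.End.eigenspace (LieAlgebra.ad ℂ L H) (j : ℂ))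
    (hgrade : ⨆ j : ℤ, g j = ⊤)
    (p n : Submodule ℂ L)
    (hp : p = ⨆ (j : ℤ) (_ : 0 ≤ j), g j)
    (hn : n = ⨆ (j : ℤ) (_ : 0 < j), g j)
    (hnice : ∃ x ∈ g 1, Submodule.map (LieAlgebra.ad ℂ L x) p = n) :
    (∀ j : ℤ, 1 < j → Module.finrank ℂ (g (j + 1)) ≤ Module.finrank ℂ (g j)) ∧
      (n ≠ ⊥ → Module.finrank ℂ (g 2) < Module.finrank ℂ (g 1)) := by
  obtain ⟨x, hx, hmap⟩ := hnice
  have hind : iSupIndep g := by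
    rw [funext hg]
    exact (Module.End.eigenspaces_iSupIndep (LieAlgebra.ad ℂ L H)).comp Int.cast_injective
  have hshift : ∀ j, ∀ y ∈ g j, LieAlgebra.ad ℂ L x y ∈ g (j + 1) := fun j y hy ↦ by
    rw [hg] at hx hy ⊢
    exact lie_mem_eigenspace_ad_add_one hx hy
  have hsurj : ∀ j : ℤ, 0 ≤ j →
      Function.Surjective ((LieAlgebra.ad ℂ L x).restrict (hshift j)) := by
    rintro j hj ⟨y, hy⟩
    have hyn : y ∈ n := hn ▸
      (le_iSup₂_of_le (f := fun i (_ : (0 : ℤ) < i) ↦ g i) (j + 1) (by lia) le_rfl) hy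
    obtain ⟨z, -, rfl⟩ := Submodule.mem_map.mp (hmap ▸ hyn)
    obtain ⟨a, ha, h⟩ := hind.exists_mem_map_eq hgrade hshift hy
    exact ⟨⟨a, ha⟩, Subtype.ext h⟩
  refine ⟨fun j hj ↦ LinearMap.finrank_le_finrank_of_surjective (hsurj j (by lia)), fun hn0 ↦ ?_⟩
  have hx0 : x ≠ 0 := by
    rintro rfl
    exact hn0 (by rw [← hmap, map_zero, Submodule.map_zero])
  have hker : LinearMap.ker ((LieAlgebra.ad ℂ L x).restrict (hshift 1)) ≠ ⊥ := fun h ↦ by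
    have hmem : (⟨x, hx⟩ : g 1) ∈ LinearMap.ker ((LieAlgebra.ad ℂ L x).restrict (hshift 1)) :=
      LinearMap.mem_ker.mpr (Subtype.ext (lie_self x))
    rw [h, Submodule.mem_bot] at hmem
    exact hx0 (congrArg Subtype.val hmem)
  have hpos := Submodule.one_le_finrank_iff.mpr hker
  have hrank := LinearMap.finrank_range_add_finrank_ker
    ((LieAlgebra.ad ℂ L x).restrict (hshift 1))
  rw [LinearMap.range_eq_top.mpr (hsurj 1 zero_le_one), finrank_top] at hrank
  change Module.finrank ℂ (g (1 + 1)) < _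
  lia
end

section
/- With g, H, the grading g_j, p and n as in the context: if there exist a nonzero x ∈ g_1 and an element y ∈ g with ⁅H, y⁆ = −y and ⁅x, y⁆ = 2H (so that {x, 2H, y} is an sl_2-triple, i.e. the parabolic p is given by an even three-dimensional simple subalgebra), then p is nice. -/
namespace IsSl2Triple

open Module LieModule

variable {K L M : Type*} [Field K] [CharZero K] [LieRing L] [LieAlgebra K L]
  [AddCommGroup M] [Module K M] [LieRingModule L M] [LieModule K L M] {h e f : L}

/-- In a finite-dimensional representation, `e` acts nilpotently on each weight vector of `h`. -/
lemma exists_pow_toEnd_e_eq_zero [FiniteDimensional K M] (t : IsSl2Triple h e f) {v : M} {μ : K}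
    (hv : ⁅h, v⁆ = μ • v) : ∃ k : ℕ, (toEnd K L M e ^ k) v = 0 := by
  by_contra! hne
  have hinj : Function.Injective fun k : ℕ ↦ μ + 2 * (k : K) := fun a b hab ↦ by
    simpa using hab
  refine Set.infinite_range_of_injective hinj
    ((Module.End.finite_hasEigenvalue (toEnd K L M h)).subset ?_)
  rintro _ ⟨k, rfl⟩
  refine Module.End.hasEigenvalue_of_hasEigenvector (x := (toEnd K L M e ^ k) v) ⟨?_, hne k⟩
  rw [Module.End.mem_eigenspace_iff, toEnd_apply_apply]
  exact t.lie_h_pow_toEnd_e hv k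

/-- On a primitive vector whose weight is not one of `0, …, n - 1`, the operator `eⁿ fⁿ` acts as a
nonzero scalar. -/
lemma HasPrimitiveVectorWith.exists_pow_toEnd_e_pow_toEnd_f {t : IsSl2Triple h e f} {w : M} {μ : K}
    (P : HasPrimitiveVectorWith t w μ) (n : ℕ) (hμ : ∀ i < n, μ ≠ (i : K)) :
    ∃ c : K, c ≠ 0 ∧ (toEnd K L M e ^ n) ((toEnd K L M f ^ n) w) = c • w := by
  induction n with
  | zero => exact ⟨1, one_ne_zero, by simp⟩
  | succ n ih =>
    obtain ⟨c, hc, hcw⟩ := ih fun i hi ↦ hμ i (hi.trans n.lt_succ_self)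
    refine ⟨(n + 1) * (μ - n) * c, mul_ne_zero (mul_ne_zero (Nat.cast_add_one_ne_zero n)
      (sub_ne_zero.mpr (hμ n n.lt_succ_self))) hc, ?_⟩
    rw [pow_succ (toEnd K L M e), Module.End.mul_apply, toEnd_apply_apply,
      P.lie_e_pow_succ_toEnd_f, map_smul, hcw, smul_smul]

/-- In a finite-dimensional representation, `e` maps the weight space of weight `m - 2` onto the
weight space of weight `m` for every positive integer `m`. -/
lemma exists_lie_e_eq [FiniteDimensional K M] (t : IsSl2Triple h e f) {v : M} {m : ℕ}
    (hm : 0 < m) (hv : ⁅h, v⁆ = (m : K) • v) :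
    ∃ u : M, ⁅h, u⁆ = (m - 2 : K) • u ∧ ⁅e, u⁆ = v := by
  obtain ⟨k, hk⟩ := t.exists_pow_toEnd_e_eq_zero hv
  induction k generalizing v with
  | zero => exact ⟨0, by simp, by simpa using hk.symm⟩
  | succ k ih =>
    by_cases hk' : (toEnd K L M e ^ k) v = 0
    · exact ih hv hk'
    set w := (toEnd K L M e ^ k) v with hw
    have P : HasPrimitiveVectorWith t w (m + 2 * k : K) :=
      ⟨hk', t.lie_h_pow_toEnd_e hv k, by rw [hw, lie_e_pow_toEnd_e, hk]⟩
    obtain ⟨c, hc, hcw⟩ := P.exists_pow_toEnd_e_pow_toEnd_f (k + 1) fun i hi ↦ by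
      norm_cast
      lia
    set u := c⁻¹ • (toEnd K L M f ^ (k + 1)) w with hu
    have hu₁ : ⁅h, u⁆ = (m - 2 : K) • u := by
      rw [hu, lie_smul, P.lie_h_pow_toEnd_f, smul_comm]
      congr 1
      push_cast
      ring
    have hu₂ : (toEnd K L M e ^ k) ⁅e, u⁆ = w := by
      rw [← toEnd_apply_apply K, ← Module.End.mul_apply, ← pow_succ, hu, map_smul, hcw,
        inv_smul_smul₀ hc]
    clear_value u
    have hu₃ : ⁅h, ⁅e, u⁆⁆ = (m : K) • ⁅e, u⁆ := by
      rw [leibniz_lie, t.lie_h_e_smul K, hu₁, smul_lie, lie_smul _ e u, ← add_smul]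
      congr 1
      ring
    obtain ⟨u', hu'₁, hu'₂⟩ := ih (v := v - ⁅e, u⁆) (by rw [lie_sub, hv, hu₃, smul_sub])
      (by rw [map_sub, hu₂, sub_self])
    exact ⟨u' + u, by rw [lie_add, hu'₁, hu₁, smul_add], by rw [lie_add, hu'₂, sub_add_cancel]⟩

end IsSl2Triple


/-- With `L`, `H`, the grading `g`, `p` and `n` as in the context:
if there exist a nonzero `x ∈ g 1` and `y ∈ L` with `⁅H, y⁆ = -y` and `⁅x, y⁆ = 2H`
(so `{x, 2H, y}` is an `sl₂`-triple, i.e. `p` is given by an even TDS), then `p` is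
nice. -/
theorem statement3
    (L : Type*) [LieRing L] [LieAlgebra ℂ L] [FiniteDimensional ℂ L]
    [LieAlgebra.IsSemisimple ℂ L]
    (H : L)
    (g : ℤ → Submodule ℂ L)
    (hg : ∀ j : ℤ, g j = Module.End.eigenspace (LieAlgebra.ad ℂ L H) (j : ℂ))
    (hgrade : ⨆ j : ℤ, g j = ⊤)
    (p n : Submodule ℂ L)
    (hp : p = ⨆ (j : ℤ) (_ : 0 ≤ j), g j)
    (hn : n = ⨆ (j : ℤ) (_ : 0 < j), g j)
    (htds : ∃ x ∈ g 1, x ≠ 0 ∧ ∃ y : L, ⁅H, y⁆ = -y ∧ ⁅x, y⁆ = (2 : ℂ) • H) :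
    ∃ x ∈ g 1, Submodule.map (LieAlgebra.ad ℂ L x) p = n := by
  obtain ⟨x, hx, hx₀, y, hHy, hxy⟩ := htds
  have mem_g {j : ℤ} {v : L} : v ∈ g j ↔ ⁅H, v⁆ = (j : ℂ) • v := by
    rw [hg, Module.End.mem_eigenspace_iff, LieAlgebra.ad_apply]
  have hHx : ⁅H, x⁆ = x := by simpa using mem_g.mp hx
  have t : IsSl2Triple ((2 : ℂ) • H) x y :=
    { h_ne_zero := by
        intro h
        have hH : H = 0 := by simpa using h
        exact hx₀ (by rw [← hHx, hH, zero_lie])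
      lie_e_f := hxy
      lie_h_e_nsmul := by rw [smul_lie, hHx, two_smul, two_nsmul]
      lie_h_f_nsmul := by rw [smul_lie, hHy, smul_neg, two_smul, two_nsmul] }
  refine ⟨x, hx, le_antisymm ?_ ?_⟩
  · rw [hp, hn]
    simp only [Submodule.map_iSup, iSup_le_iff, Submodule.map_le_iff_le_comap]
    intro j hj v hv
    refine Submodule.mem_iSup_of_mem (j + 1) (Submodule.mem_iSup_of_mem (by lia) ?_)
    rw [LieAlgebra.ad_apply, mem_g, leibniz_lie, hHx, mem_g.mp hv, lie_smul]
    push_cast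
    rw [add_smul, one_smul, add_comm]
  · rw [hn]
    simp only [iSup_le_iff]
    intro j hj v hv
    obtain ⟨m, rfl⟩ := Int.eq_ofNat_of_zero_le hj.le
    obtain ⟨u, hu, rfl⟩ := t.exists_lie_e_eq (K := ℂ) (v := v) (m := 2 * m) (by lia) (by
      rw [smul_lie, mem_g.mp hv, smul_smul]
      push_cast
      rfl)
    refine Submodule.mem_map_of_mem (f := LieAlgebra.ad ℂ L x) ?_
    rw [hp]
    refine Submodule.mem_iSup_of_mem (m - 1 : ℤ) (Submodule.mem_iSup_of_mem (by lia) ?_)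
    rw [mem_g]
    apply smul_right_injective L (two_ne_zero (α := ℂ))
    simp only
    rw [← smul_lie, hu, smul_smul]
    congr 1
    push_cast
    ring
end

section
/- With g, H, the grading g_j, p and n as in the context: an element x ∈ g_1 satisfies ⁅p, x⁆ = n (i.e. x is a Richardson element of p) if and only if dim_ℂ g^x = dim_ℂ g_0, where g^x = {y ∈ g : ⁅x, y⁆ = 0} is the centralizer of x in g and g_0 is the Levi factor of p. -/
open LinearMap Module Submodule in
/-- Let `p = n ⊕ g₀` and `V = n ⊕ q = p ⊕ m`, where `p ⊥ n` and `q ⊥ m` for a nondegenerate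
bilinear form. A skew-adjoint endomorphism `T` with `T p ⊆ n` and `T m ⊆ q` satisfies `T p = n`
if and only if its kernel has the dimension of `g₀`. -/
theorem map_eq_iff_finrank_ker_eq_of_skewAdjoint
    {K V : Type*} [Field K] [AddCommGroup V] [Module K V] [FiniteDimensional K V]
    {B : LinearMap.BilinForm K V} (hB : B.Nondegenerate)
    {T : End K V} (hT : ∀ y z, B (T y) z = - B y (T z))
    {p n q m g₀ : Submodule K V} (hnq : IsCompl n q) (hpm : IsCompl p m)
    (hp : n ⊔ g₀ = p) (hg₀ : Disjoint n g₀)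
    (hpn : ∀ y ∈ p, ∀ z ∈ n, B y z = 0) (hqm : ∀ y ∈ q, ∀ z ∈ m, B y z = 0)
    (hTp : p ≤ n.comap T) (hTm : m ≤ q.comap T) :
    p.map T = n ↔ finrank K (ker T) = finrank K g₀ := by
  have h1 := finrank_add_eq_of_isCompl hnq
  have h2 := finrank_add_eq_of_isCompl hpm
  have h3 := finrank_sup_add_finrank_inf_eq n g₀
  rw [hp, hg₀.eq_bot, finrank_bot] at h3
  have o1 := LinearMap.BilinForm.finrank_orthogonal hB p
  have o2 := LinearMap.BilinForm.finrank_orthogonal hB q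
  have hle1 : n ≤ B.orthogonal p := fun z hz y hy ↦ hpn y hy z hz
  have hle2 : m ≤ B.orthogonal q := fun z hz y hy ↦ hqm y hy z hz
  have l1 := finrank_mono hle1
  have l2 := finrank_mono hle2
  have horth : B.orthogonal p = n := (eq_of_le_of_finrank_eq hle1 (by omega)).symm
  have hcomap : n.comap T = B.orthogonal (p.map T) := by
    ext y
    rw [mem_comap, ← horth, LinearMap.BilinForm.mem_orthogonal_iff, LinearMap.BilinForm.mem_orthogonal_iff]
    constructor
    · rintro h _ ⟨z, hz, rfl⟩
      rw [hT, h z hz, neg_zero]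
    · intro h z hz
      have := h _ (mem_map_of_mem hz)
      rwa [hT, neg_eq_zero] at this
  have hcomap' : n.comap T = p ⊔ ker T := by
    refine le_antisymm (fun y hy ↦ ?_) (sup_le hTp (LinearMap.ker_le_comap T))
    obtain ⟨v, hv, u, hu, rfl⟩ := mem_sup.mp (hpm.sup_eq_top ▸ mem_top : y ∈ p ⊔ m)
    have hn : T u ∈ n := by
      have : T (v + u) ∈ n := hy
      rw [map_add] at this
      exact (n.add_mem_iff_right (hTp hv)).mp this
    have : T u = 0 := disjoint_def.mp hnq.disjoint _ hn (hTm hu)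
    exact add_mem_sup hv (LinearMap.mem_ker.mpr this)
  have o3 := LinearMap.BilinForm.finrank_orthogonal hB (p.map T)
  rw [← hcomap, hcomap'] at o3
  have h4 := finrank_sup_add_finrank_inf_eq p (ker T)
  have h5 := finrank_range_add_finrank_ker (T.domRestrict p)
  rw [range_domRestrict, ker_domRestrict,
    ← finrank_map_subtype_eq, map_comap_subtype] at h5
  have hmap : p.map T ≤ n := map_le_iff_le_comap.mpr hTp
  have l3 := finrank_mono hmap
  have l4 := Submodule.finrank_le (p.map T)
  constructor
  · intro h
    rw [h] at o3 h5
    omega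
  · intro h
    exact eq_of_le_of_finrank_eq hmap (by omega)

section Grading

variable {K L : Type*} [Field K] [LieRing L] [LieAlgebra K L]

open LieAlgebra Module

theorem lie_mem_eigenspace_ad {H y z : L} {a b : K}
    (hy : y ∈ End.eigenspace (ad K L H) a) (hz : z ∈ End.eigenspace (ad K L H) b) :
    ⁅y, z⁆ ∈ End.eigenspace (ad K L H) (a + b) := by
  rw [End.mem_eigenspace_iff, ad_apply] at *
  rw [leibniz_lie, hy, hz, smul_lie, lie_smul, add_smul]

theorem killingForm_eq_zero_of_mem_eigenspace_ad {H y z : L} {a b : K} (hab : a + b ≠ 0)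
    (hy : y ∈ End.eigenspace (ad K L H) a) (hz : z ∈ End.eigenspace (ad K L H) b) :
    killingForm K L y z = 0 := by
  rw [End.mem_eigenspace_iff, ad_apply] at hy hz
  have h := LieModule.traceForm_apply_lie_apply' K L L H y z
  rw [hy, hz, map_smul, map_smul, LinearMap.smul_apply, smul_eq_mul, smul_eq_mul] at h
  have h' : (a + b) * killingForm K L y z = 0 := by linear_combination h
  exact (mul_eq_zero.mp h').resolve_left hab

end Grading

/-- With `L`, `H`, the grading `g`, `p` and `n` as in the context:
an element `x ∈ g 1` satisfies `⁅p, x⁆ = n` (i.e. `x` is a Richardson element of `p`)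
if and only if `dim g^x = dim (g 0)`, where `g^x = ker (ad x)` is the centralizer of
`x` in `L` and `g 0` is the Levi factor of `p`. -/
theorem statement4
    (L : Type*) [LieRing L] [LieAlgebra ℂ L] [FiniteDimensional ℂ L]
    [LieAlgebra.IsSemisimple ℂ L]
    (H : L)
    (g : ℤ → Submodule ℂ L)
    (hg : ∀ j : ℤ, g j = Module.End.eigenspace (LieAlgebra.ad ℂ L H) (j : ℂ))
    (hgrade : ⨆ j : ℤ, g j = ⊤)
    (p n : Submodule ℂ L)
    (hp : p = ⨆ (j : ℤ) (_ : 0 ≤ j), g j)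
    (hn : n = ⨆ (j : ℤ) (_ : 0 < j), g j)
    (x : L) (hx : x ∈ g 1) :
    Submodule.map (LieAlgebra.ad ℂ L x) p = n ↔
      Module.finrank ℂ (LinearMap.ker (LieAlgebra.ad ℂ L x)) =
        Module.finrank ℂ (g 0) := by
  have hind : iSupIndep g := by
    have : g = (Module.End.eigenspace (LieAlgebra.ad ℂ L H)) ∘ fun j : ℤ ↦ (j : ℂ) := funext hg
    rw [this]
    exact (Module.End.eigenspaces_iSupIndep _).comp Int.cast_injective
  have hle (P : ℤ → Prop) {j : ℤ} (hj : P j) : g j ≤ ⨆ (j : ℤ) (_ : P j), g j :=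
    le_iSup₂_of_le j hj le_rfl
  have hdisj (P Q : ℤ → Prop) (h : ∀ j, P j → ¬ Q j) :
      Disjoint (⨆ (j : ℤ) (_ : P j), g j) (⨆ (j : ℤ) (_ : Q j), g j) :=
    hind.disjoint_biSup_biSup (s := {j | P j}) (t := {j | Q j}) (Set.disjoint_left.mpr h)
  have hcompl (P Q : ℤ → Prop) (h : ∀ j, P j ↔ ¬ Q j) :
      IsCompl (⨆ (j : ℤ) (_ : P j), g j) (⨆ (j : ℤ) (_ : Q j), g j) := by
    refine ⟨hdisj P Q fun j ↦ (h j).mp, codisjoint_iff_le_sup.mpr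
      (hgrade.ge.trans (iSup_le fun j ↦ ?_))⟩
    by_cases hj : Q j
    · exact (hle Q hj).trans le_sup_right
    · exact (hle P ((h j).mpr hj)).trans le_sup_left
  have hshift (P Q : ℤ → Prop) (h : ∀ j, P j → Q (1 + j)) :
      (⨆ (j : ℤ) (_ : P j), g j) ≤
        (⨆ (j : ℤ) (_ : Q j), g j).comap (LieAlgebra.ad ℂ L x) := by
    refine iSup₂_le fun j hj y hy ↦ ?_
    refine Submodule.mem_iSup_of_mem (1 + j) (Submodule.mem_iSup_of_mem (h j hj) ?_)
    rw [hg] at hx hy ⊢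
    rw [Int.cast_add]
    exact lie_mem_eigenspace_ad hx hy
  have horth (P Q : ℤ → Prop) (h : ∀ i j, P i → Q j → i + j ≠ 0) :
      ∀ y ∈ (⨆ (j : ℤ) (_ : P j), g j), ∀ z ∈ (⨆ (j : ℤ) (_ : Q j), g j),
        killingForm ℂ L y z = 0 := by
    intro y hy z hz
    suffices (⨆ (j : ℤ) (_ : P j), g j) ≤ LinearMap.ker ((killingForm ℂ L).flip z) from this hy
    refine iSup₂_le fun i hi y hy ↦ ?_
    suffices (⨆ (j : ℤ) (_ : Q j), g j) ≤ LinearMap.ker (killingForm ℂ L y) from this hz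
    refine iSup₂_le fun j hj z hz ↦ ?_
    rw [hg] at hy hz
    exact killingForm_eq_zero_of_mem_eigenspace_ad (mod_cast h i j hi hj) hy hz
  subst hp hn
  have hp' : (⨆ (j : ℤ) (_ : 0 < j), g j) ⊔ g 0 = ⨆ (j : ℤ) (_ : 0 ≤ j), g j := by
    refine le_antisymm (sup_le (iSup₂_le fun j hj ↦ hle (0 ≤ ·) hj.le)
      (hle (0 ≤ ·) le_rfl)) (iSup₂_le fun j hj ↦ ?_)
    rcases hj.eq_or_lt with rfl | hj
    · exact le_sup_right
    · exact (hle (0 < ·) hj).trans le_sup_left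
  have hn0 : Disjoint (⨆ (j : ℤ) (_ : 0 < j), g j) (g 0) := by
    have := hdisj (0 < ·) (· = 0) fun j h ↦ h.ne'
    rwa [iSup_iSup_eq_left] at this
  have hskew (y z : L) : killingForm ℂ L (LieAlgebra.ad ℂ L x y) z =
      - killingForm ℂ L y (LieAlgebra.ad ℂ L x z) := by
    simpa only [LieAlgebra.ad_apply] using LieModule.traceForm_apply_lie_apply' ℂ L L x y z
  refine map_eq_iff_finrank_ker_eq_of_skewAdjoint
    (LieAlgebra.IsKilling.killingForm_nondegenerate ℂ L)
    hskew
    (q := ⨆ (j : ℤ) (_ : j ≤ 0), g j) (m := ⨆ (j : ℤ) (_ : j < 0), g j) ?_ ?_ hp' hn0 ?_ ?_ ?_ ?_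
  · exact hcompl _ _ fun j ↦ not_le.symm
  · exact hcompl _ _ fun j ↦ not_lt.symm
  · exact horth _ _ fun i j hi hj ↦ by omega
  · exact horth _ _ fun i j hi hj ↦ by omega
  · exact hshift _ _ fun j hj ↦ by omega
  · exact hshift _ _ fun j hj ↦ by omega
end

section
/- For every n ≥ 1, the number of unimodal palindromic compositions of n equals the number of partitions of n all of whose parts are odd plus the number of partitions of n all of whose parts are even. (This is the combinatorial content of the paper's identity Σ_{j≥1} q^j(1+q^j)/Π_{i=1}^{j}(1−q^{2i}) = 1/Π_{i≥1}(1−q^{2i−1}) + 1/Π_{i≥1}(1−q^{2i}), reflecting that both sides count the even nilpotent orbits of sl_n.) -/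
/-- A list of naturals is unimodal if there is an index `t` such that the list is
nondecreasing up to position `t` and nonincreasing from position `t` on. -/
def IsUnimodalList (l : List ℕ) : Prop :=
  ∃ t : ℕ, ∀ i j : ℕ, i ≤ j → j < l.length →
    (j ≤ t → l.getD i 0 ≤ l.getD j 0) ∧ (t ≤ i → l.getD j 0 ≤ l.getD i 0)

/-- The number of unimodal palindromic compositions of `n`: lists of positive integers
summing to `n` which are palindromic and unimodal. -/
noncomputable def numUPC (n : ℕ) : ℕ :=
  Nat.card {l : List ℕ // (∀ x ∈ l, 0 < x) ∧ l.sum = n ∧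
    l.reverse = l ∧ IsUnimodalList l}

section

open Cardinal

/-- Multisets of positive integers at most `m` with sum `k`. -/
def boundedParts (k m : ℕ) : Set (Multiset ℕ) :=
  {s | (∀ x ∈ s, 0 < x ∧ x ≤ m) ∧ s.sum = k}

/-- Multisets of `m` natural numbers with sum `k`. -/
def boundedCard (k m : ℕ) : Set (Multiset ℕ) :=
  {t | t.card = m ∧ t.sum = k}

theorem sum_map_two_mul (t : Multiset ℕ) : (t.map (2 * ·)).sum = 2 * t.sum := by
  simpa using Multiset.sum_map_mul_left (s := t) (a := 2) (f := id)

theorem sum_map_add_one (t : Multiset ℕ) : (t.map (· + 1)).sum = t.sum + t.card := by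
  simp [Multiset.sum_map_add]

theorem map_sub_one_map_add_one {t : Multiset ℕ} (h : 0 ∉ t) :
    (t.map (· - 1)).map (· + 1) = t := by
  rw [Multiset.map_map]
  conv_rhs => rw [← Multiset.map_id t]
  refine Multiset.map_congr rfl fun x hx => ?_
  have : x ≠ 0 := fun h0 => h (h0 ▸ hx)
  simp only [Function.comp, id]
  omega

theorem boundedParts_succ_of_lt {k m : ℕ} (h : k < m + 1) :
    boundedParts k (m + 1) = boundedParts k m := by
  ext s
  refine and_congr_left fun hs => forall₂_congr fun x hx => and_congr_right fun _ => ?_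
  have := Multiset.le_sum_of_mem hx
  omega

theorem boundedParts_add_succ (k m : ℕ) :
    boundedParts (k + (m + 1)) (m + 1) =
      boundedParts (k + (m + 1)) m ∪ Multiset.cons (m + 1) '' boundedParts k (m + 1) := by
  ext s
  constructor
  · rintro ⟨h, hs⟩
    by_cases hm : m + 1 ∈ s
    · obtain ⟨t, rfl⟩ := Multiset.exists_cons_of_mem hm
      refine Or.inr ⟨t, ⟨fun x hx => h x (Multiset.mem_cons_of_mem hx), ?_⟩, rfl⟩
      rw [Multiset.sum_cons] at hs
      omega
    · refine Or.inl ⟨fun x hx => ⟨(h x hx).1, ?_⟩, hs⟩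
      have : x ≠ m + 1 := fun h0 => hm (h0 ▸ hx)
      have := (h x hx).2
      omega
  · rintro (⟨h, hs⟩ | ⟨t, ⟨h, hs⟩, rfl⟩)
    · exact ⟨fun x hx => ⟨(h x hx).1, (h x hx).2.trans (Nat.le_succ m)⟩, hs⟩
    · refine ⟨fun x hx => ?_, by rw [Multiset.sum_cons, hs, add_comm]⟩
      rcases Multiset.mem_cons.1 hx with rfl | hx
      · omega
      · exact h x hx

theorem boundedCard_succ_of_lt {k m : ℕ} (h : k < m + 1) :
    boundedCard k (m + 1) = Multiset.cons 0 '' boundedCard k m := by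
  ext t
  constructor
  · rintro ⟨hc, hs⟩
    by_cases h0 : 0 ∈ t
    · obtain ⟨u, rfl⟩ := Multiset.exists_cons_of_mem h0
      exact ⟨u, ⟨by simpa using hc, by simpa using hs⟩, rfl⟩
    · have := sum_map_add_one (t.map (· - 1))
      rw [map_sub_one_map_add_one h0, Multiset.card_map] at this
      omega
  · rintro ⟨u, ⟨hc, hs⟩, rfl⟩
    exact ⟨by simpa using hc, by simpa using hs⟩

theorem boundedCard_add_succ (k m : ℕ) :
    boundedCard (k + (m + 1)) (m + 1) =
      Multiset.cons 0 '' boundedCard (k + (m + 1)) m ∪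
        Multiset.map (· + 1) '' boundedCard k (m + 1) := by
  ext t
  constructor
  · rintro ⟨hc, hs⟩
    by_cases h0 : 0 ∈ t
    · obtain ⟨u, rfl⟩ := Multiset.exists_cons_of_mem h0
      exact Or.inl ⟨u, ⟨by simpa using hc, by simpa using hs⟩, rfl⟩
    · refine Or.inr ⟨t.map (· - 1), ⟨by simpa using hc, ?_⟩, map_sub_one_map_add_one h0⟩
      have := sum_map_add_one (t.map (· - 1))
      rw [map_sub_one_map_add_one h0, Multiset.card_map] at this
      omega
  · rintro (⟨u, ⟨hc, hs⟩, rfl⟩ | ⟨u, ⟨hc, hs⟩, rfl⟩)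
    · exact ⟨by simpa using hc, by simpa using hs⟩
    · exact ⟨by simpa using hc, by rw [sum_map_add_one, hc, hs]⟩

/-- Conjugation of partitions, at the level of cardinalities. -/
theorem mk_boundedParts (k m : ℕ) : #(boundedParts k m) = #(boundedCard k m) := by
  induction m generalizing k with
  | zero =>
    congr 2
    ext s
    refine and_congr_left fun _ => ⟨fun h => ?_, fun h x hx => ?_⟩
    · refine Multiset.card_eq_zero.2 (Multiset.eq_zero_of_forall_notMem fun x hx => ?_)
      have := h x hx
      omega
    · simp [Multiset.card_eq_zero.1 h] at hx
  | succ m ihm =>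
    induction k using Nat.strong_induction_on with
    | _ k ihk =>
      have hcons (a : ℕ) : Function.Injective (Multiset.cons a) := fun _ _ h => by simpa using h
      rcases lt_or_ge k (m + 1) with h | h
      · rw [boundedParts_succ_of_lt h, boundedCard_succ_of_lt h, mk_image_eq (hcons 0), ihm]
      · obtain ⟨k, rfl⟩ := Nat.exists_eq_add_of_le' h
        rw [boundedParts_add_succ, boundedCard_add_succ, mk_union_of_disjoint,
          mk_union_of_disjoint, mk_image_eq (hcons _), mk_image_eq (hcons _),
          mk_image_eq (Multiset.map_injective (add_left_injective 1)), ihm, ihk k (by omega)]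
        · rw [Set.disjoint_left]
          rintro _ ⟨u, -, rfl⟩ ⟨v, -, h⟩
          have : 0 ∈ v.map (· + 1) := h ▸ Multiset.mem_cons_self 0 u
          simp at this
        · rw [Set.disjoint_left]
          rintro _ ⟨h, -⟩ ⟨v, -, rfl⟩
          have := (h _ (Multiset.mem_cons_self _ _)).2
          omega

theorem isUnimodalList_iff_of_reverse_eq {l : List ℕ} (hl : l.reverse = l) :
    IsUnimodalList l ↔ (l.take ((l.length + 1) / 2)).Pairwise (· ≤ ·) := by
  have hrev (i : ℕ) (hi : i < l.length) : l.getD (l.length - 1 - i) 0 = l.getD i 0 := by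
    conv_rhs => rw [← hl]
    rw [List.getD_eq_getElem _ _ (by omega), List.getD_eq_getElem _ _ (by simpa using hi),
      List.getElem_reverse]
  have hpair : (l.take ((l.length + 1) / 2)).Pairwise (· ≤ ·) ↔
      ∀ i j, i ≤ j → 2 * j < l.length → l.getD i 0 ≤ l.getD j 0 := by
    rw [List.pairwise_iff_getElem]
    constructor
    · intro h i j hij hj
      rcases hij.eq_or_lt with rfl | hij
      · exact le_rfl
      · have := h i j (by simp; omega) (by simp; omega) hij
        rw [List.getD_eq_getElem _ _ (by omega), List.getD_eq_getElem _ _ (by omega)]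
        simpa using this
    · intro h i j hi hj hij
      simp only [List.length_take] at hi hj
      have := h i j hij.le (by omega)
      rw [List.getD_eq_getElem _ _ (by omega), List.getD_eq_getElem _ _ (by omega)] at this
      simpa using this
  rw [hpair]
  constructor
  · rintro ⟨t, ht⟩ i j hij hj
    rcases le_or_gt j t with hjt | hjt
    · exact (ht i j hij (by omega)).1 hjt
    · rw [← hrev i (by omega), ← hrev j (by omega)]
      exact (ht _ _ (by omega) (by omega)).2 (by omega)
  · intro h
    refine ⟨l.length / 2, fun i j hij hj => ⟨fun hjt => ?_, fun hit => ?_⟩⟩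
    · rcases Nat.lt_or_ge (2 * j) l.length with hj' | hj'
      · exact h i j hij hj'
      · rcases hij.eq_or_lt with rfl | hij
        · exact le_rfl
        · rw [← hrev j hj]
          exact h _ _ (by omega) (by omega)
    · rw [← hrev i (by omega), ← hrev j (by omega)]
      exact h _ _ (by omega) (by omega)

/-- The palindrome of even length whose first half is `s`, sorted. -/
def evenMirror (s : Multiset ℕ) : List ℕ :=
  s.sort ++ s.sort.reverse

/-- The palindrome of odd length with middle entry `m` whose first half is `s`, sorted. -/
def oddMirror (m : ℕ) (s : Multiset ℕ) : List ℕ :=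
  s.sort ++ m :: s.sort.reverse

theorem evenMirror_injective : Function.Injective evenMirror := by
  intro s t h
  have hlen := congrArg List.length h
  simp only [evenMirror, List.length_append, List.length_reverse] at hlen
  rw [← s.sort_eq (· ≤ ·), (List.append_inj h (by omega)).1, t.sort_eq]

theorem oddMirror_inj {m m' : ℕ} {s t : Multiset ℕ} (h : oddMirror m s = oddMirror m' t) :
    m = m' ∧ s = t := by
  have hlen := congrArg List.length h
  simp only [oddMirror, List.length_append, List.length_cons, List.length_reverse] at hlen
  have := List.append_inj h (by omega)
  refine ⟨(List.cons_eq_cons.1 this.2).1, ?_⟩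
  rw [← s.sort_eq (· ≤ ·), this.1, t.sort_eq]

theorem sum_sort (s : Multiset ℕ) : s.sort.sum = s.sum := by
  conv_rhs => rw [← s.sort_eq (· ≤ ·), Multiset.sum_coe]

theorem isUnimodalList_evenMirror (s : Multiset ℕ) : IsUnimodalList (evenMirror s) := by
  rw [isUnimodalList_iff_of_reverse_eq (by simp [evenMirror])]
  have : ((evenMirror s).length + 1) / 2 = s.sort.length := by
    simp [evenMirror]; omega
  rw [this, evenMirror, List.take_left]
  exact s.pairwise_sort _

theorem isUnimodalList_oddMirror {m : ℕ} {s : Multiset ℕ} (h : ∀ x ∈ s, x ≤ m) :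
    IsUnimodalList (oddMirror m s) := by
  rw [isUnimodalList_iff_of_reverse_eq (by simp [oddMirror])]
  have : ((oddMirror m s).length + 1) / 2 = (s.sort ++ [m]).length := by
    simp [oddMirror]; omega
  rw [this, oddMirror, List.append_cons _ m (List.reverse _), List.take_left]
  simpa [List.pairwise_append] using h

theorem eq_evenMirror_or_eq_oddMirror {l : List ℕ} (hl : l.reverse = l) (hu : IsUnimodalList l) :
    (∃ s, l = evenMirror s) ∨ ∃ m s, (∀ x ∈ s, x ≤ m) ∧ l = oddMirror m s := by
  rw [isUnimodalList_iff_of_reverse_eq hl] at hu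
  obtain ⟨k, hk | hk⟩ := Nat.even_or_odd' l.length
  · left
    refine ⟨(l.take k : List ℕ), ?_⟩
    rw [show (l.length + 1) / 2 = k by omega] at hu
    rw [evenMirror, Multiset.coe_sort, List.mergeSort_eq_self _ hu, List.reverse_take, hl,
      show l.length - k = k by omega, List.take_append_drop]
  · right
    rw [show (l.length + 1) / 2 = k + 1 by omega, ← List.take_append_getElem (by omega),
      List.pairwise_append] at hu
    refine ⟨l[k], (l.take k : List ℕ), by simpa using hu.2.2, ?_⟩
    rw [oddMirror, Multiset.coe_sort, List.mergeSort_eq_self _ hu.1, List.reverse_take, hl,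
      show l.length - k = k + 1 by omega, List.cons_getElem_drop_succ, List.take_append_drop]

theorem setOf_upc_eq {n : ℕ} (hn : 1 ≤ n) :
    {l : List ℕ | (∀ x ∈ l, 0 < x) ∧ l.sum = n ∧ l.reverse = l ∧ IsUnimodalList l} =
      evenMirror '' {s | (∀ x ∈ s, 0 < x) ∧ 2 * s.sum = n} ∪
        ⋃ m, oddMirror m '' {s | (∀ x ∈ s, 0 < x ∧ x ≤ m) ∧ 2 * s.sum + m = n} := by
  ext l
  constructor
  · rintro ⟨hpos, hsum, hl, hu⟩
    obtain ⟨s, rfl⟩ | ⟨m, s, hm, rfl⟩ := eq_evenMirror_or_eq_oddMirror hl hu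
    · refine Or.inl ⟨s, ⟨fun x hx => hpos x (by simp [evenMirror, hx]), ?_⟩, rfl⟩
      simp only [evenMirror, List.sum_append, List.sum_reverse, sum_sort] at hsum
      omega
    · refine Or.inr (Set.mem_iUnion.2 ⟨m, s,
        ⟨fun x hx => ⟨hpos x (by simp [oddMirror, hx]), hm x hx⟩, ?_⟩, rfl⟩)
      simp only [oddMirror, List.sum_append, List.sum_cons, List.sum_reverse, sum_sort] at hsum
      omega
  · rintro (⟨s, ⟨hpos, hsum⟩, rfl⟩ | hl)
    · refine ⟨fun x hx => hpos x (by simpa [evenMirror] using hx), ?_, by simp [evenMirror],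
        isUnimodalList_evenMirror s⟩
      simp only [evenMirror, List.sum_append, List.sum_reverse, sum_sort]
      omega
    · obtain ⟨m, s, ⟨h, hsum⟩, rfl⟩ := Set.mem_iUnion.1 hl
      have hm : 0 < m := by
        by_contra hm
        have hs : s = 0 := Multiset.eq_zero_of_forall_notMem fun x hx => by
          have := h x hx
          omega
        rw [hs, Multiset.sum_zero] at hsum
        omega
      refine ⟨fun x hx => ?_, ?_, by simp [oddMirror],
        isUnimodalList_oddMirror fun x hx => (h x hx).2⟩
      · have : x ∈ s ∨ x = m := by
          simp only [oddMirror, List.mem_append, List.mem_cons, List.mem_reverse,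
            Multiset.mem_sort] at hx
          tauto
        rcases this with hx | rfl
        · exact (h x hx).1
        · exact hm
      · simp only [oddMirror, List.sum_append, List.sum_cons, List.sum_reverse, sum_sort]
        omega

theorem mk_partitions_of_injective {f : ℕ → ℕ} (hf : Function.Injective f) (n : ℕ) :
    #{p : n.Partition // ∀ i ∈ p.parts, i ∈ Set.range f} =
      #{t : Multiset ℕ | (∀ x ∈ t, 0 < f x) ∧ (t.map f).sum = n} := by
  symm
  refine mk_congr (Equiv.ofBijective (fun t => ⟨⟨t.1.map f, ?_, t.2.2⟩, ?_⟩) ⟨?_, ?_⟩)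
  · intro i hi
    obtain ⟨x, hx, rfl⟩ := Multiset.mem_map.1 hi
    exact t.2.1 x hx
  · intro i hi
    obtain ⟨x, -, rfl⟩ := Multiset.mem_map.1 hi
    exact ⟨x, rfl⟩
  · intro s t h
    simp only [Subtype.mk.injEq, Nat.Partition.mk.injEq] at h
    exact Subtype.ext (Multiset.map_injective hf h)
  · rintro ⟨⟨s, hpos, hsum⟩, hs⟩
    have hmap : (s.map (Function.invFun f)).map f = s := by
      rw [Multiset.map_map]
      conv_rhs => rw [← Multiset.map_id s]
      exact Multiset.map_congr rfl fun x hx => Function.invFun_eq (hs x hx)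
    refine ⟨⟨s.map (Function.invFun f), fun x hx => hpos ?_, by rw [hmap, hsum]⟩, ?_⟩
    · rw [← hmap]
      exact Multiset.mem_map_of_mem f hx
    · simp only [hmap]

theorem mk_even_partitions (n : ℕ) :
    #{p : n.Partition // ∀ i ∈ p.parts, Even i} =
      #{s : Multiset ℕ | (∀ x ∈ s, 0 < x) ∧ 2 * s.sum = n} := by
  have := mk_partitions_of_injective (f := fun x => 2 * x) (fun _ _ h => by simpa using h) n
  simpa [sum_map_two_mul, even_iff_exists_two_mul, eq_comm] using this

theorem mk_odd_partitions (n : ℕ) :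
    #{p : n.Partition // ∀ i ∈ p.parts, Odd i} =
      #{t : Multiset ℕ | 2 * t.sum + t.card = n} := by
  have := mk_partitions_of_injective (f := fun x => 2 * x + 1) (fun _ _ h => by simpa using h) n
  simpa [Multiset.sum_map_add, sum_map_two_mul, Odd, eq_comm] using this

theorem mk_bounded_pair (n m : ℕ) :
    #{s : Multiset ℕ | (∀ x ∈ s, 0 < x ∧ x ≤ m) ∧ 2 * s.sum + m = n} =
      #{t : Multiset ℕ | t.card = m ∧ 2 * t.sum + m = n} := by
  by_cases h : ∃ k, 2 * k + m = n
  · obtain ⟨k, rfl⟩ := h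
    simpa [boundedParts, boundedCard] using mk_boundedParts k m
  · push Not at h
    simp [h]

theorem mk_setOf_upc {n : ℕ} (hn : 1 ≤ n) :
    #{l : List ℕ | (∀ x ∈ l, 0 < x) ∧ l.sum = n ∧ l.reverse = l ∧ IsUnimodalList l} =
      #{p : n.Partition // ∀ i ∈ p.parts, Odd i} +
        #{p : n.Partition // ∀ i ∈ p.parts, Even i} := by
  have hdisj : Pairwise (Function.onFun Disjoint fun m => oddMirror m ''
      {s | (∀ x ∈ s, 0 < x ∧ x ≤ m) ∧ 2 * s.sum + m = n}) := by
    refine fun m m' hm => Set.disjoint_left.2 ?_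
    rintro _ ⟨s, -, rfl⟩ ⟨t, -, h⟩
    exact hm (oddMirror_inj h).1.symm
  have hunion : {t : Multiset ℕ | 2 * t.sum + t.card = n} =
      ⋃ m, {t : Multiset ℕ | t.card = m ∧ 2 * t.sum + m = n} := by
    ext t
    simp
  rw [setOf_upc_eq hn, mk_union_of_disjoint, mk_image_eq evenMirror_injective,
    mk_iUnion_eq_sum_mk hdisj, mk_even_partitions, mk_odd_partitions, hunion,
    mk_iUnion_eq_sum_mk, add_comm]
  · congr 2
    funext m
    rw [mk_image_eq fun _ _ h => (oddMirror_inj h).2, mk_bounded_pair]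
  · refine fun m m' hm => Set.disjoint_left.2 ?_
    rintro t ⟨rfl, -⟩ ⟨h, -⟩
    exact hm h
  · rw [Set.disjoint_left]
    rintro _ ⟨s, -, rfl⟩ h
    obtain ⟨m, t, -, h⟩ := Set.mem_iUnion.1 h
    have := congrArg List.length h
    simp only [evenMirror, oddMirror, List.length_append, List.length_cons,
      List.length_reverse] at this
    omega

end

/-- For every `n ≥ 1`, the number of unimodal palindromic
compositions of `n` equals the number of partitions of `n` all of whose parts are odd
plus the number of partitions of `n` all of whose parts are even. -/
theorem statement17 (n : ℕ) (hn : 1 ≤ n) :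
    numUPC n =
      Nat.card {p : n.Partition // ∀ i ∈ p.parts, Odd i} +
        Nat.card {p : n.Partition // ∀ i ∈ p.parts, Even i} := by
  rw [numUPC, ← Nat.card_sum]
  simp only [Nat.card, Cardinal.mk_sum, Cardinal.lift_id]
  exact congrArg Cardinal.toNat (mk_setOf_upc hn)
end

section
/- Let p, q be natural numbers and let S ∈ M_p(ℂ) be a symmetric matrix (Sᵀ = S). Then there exists X ∈ M_{p×q}(ℂ) with S = X Xᵀ if and only if rank(S) ≤ q. -/
open Matrix

/-- A symmetric matrix over a field of characteristic not two is congruent to a diagonal matrix. -/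
theorem Matrix.exists_eq_mul_diagonal_mul_transpose {n K : Type*} [Fintype n] [DecidableEq n]
    [Field K] [Invertible (2 : K)] (S : Matrix n n K) (hS : Sᵀ = S) :
    ∃ (P : Matrix n n K) (d : n → K), IsUnit P.det ∧ S = P * diagonal d * Pᵀ := by
  have hB : LinearMap.IsSymm (Matrix.toBilin' S) := by
    refine ⟨fun x y => ?_⟩
    rw [Matrix.toBilin'_apply', Matrix.toBilin'_apply', RingHom.id_apply, dotProduct_mulVec,
      dotProduct_comm, ← mulVec_transpose, hS]
  obtain ⟨v', hv'⟩ := LinearMap.BilinForm.exists_orthogonal_basis hB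
  let σ : Fin (Module.finrank K (n → K)) ≃ n :=
    Fintype.equivOfCardEq (by simp)
  let v := v'.reindex σ
  let P := v.toMatrix (Pi.basisFun K n)
  refine ⟨Pᵀ, fun i => Matrix.toBilin' S (v i) (v i), ?_, ?_⟩
  · rw [det_transpose]
    exact v.isUnit_det (Pi.basisFun K n)
  · have hD : LinearMap.BilinForm.toMatrix v (Matrix.toBilin' S) =
        diagonal fun i => Matrix.toBilin' S (v i) (v i) := by
      ext i j
      rw [LinearMap.BilinForm.toMatrix_apply]
      rcases eq_or_ne i j with rfl | hij
      · simp
      · rw [diagonal_apply_ne _ hij]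
        simpa [v] using hv' (σ.symm.injective.ne hij)
    rw [transpose_transpose, ← hD,
      LinearMap.BilinForm.toMatrix_mul_basis_toMatrix, LinearMap.BilinForm.toMatrix_basisFun,
      LinearMap.BilinForm.toMatrix'_toBilin']

/-- Over an algebraically closed field, a diagonal matrix of rank at most `Fintype.card m`
factors as `Z * Zᵀ` with columns indexed by `m`. -/
theorem Matrix.exists_diagonal_eq_mul_transpose {n m K : Type*} [Fintype n] [DecidableEq n]
    [Fintype m] [Field K] [IsAlgClosed K] (d : n → K)
    (hd : (diagonal d).rank ≤ Fintype.card m) :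
    ∃ Z : Matrix n m K, diagonal d = Z * Zᵀ := by
  classical
  rw [rank_diagonal] at hd
  obtain ⟨e⟩ := Function.Embedding.nonempty_of_card_le hd
  choose s hs using fun i => IsAlgClosed.exists_eq_mul_self (d i)
  let Y : Matrix n {i // d i ≠ 0} K := (diagonal s).submatrix id Subtype.val
  let E : Matrix {i // d i ≠ 0} m K := (1 : Matrix m m K).submatrix e id
  have hE : E * Eᵀ = 1 := by
    rw [transpose_submatrix, transpose_one, ← submatrix_mul _ _ _ _ _ Function.bijective_id,
      Matrix.one_mul, submatrix_one_embedding]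
  have hY : Y * Yᵀ = diagonal d := by
    ext i j
    by_cases hi : d i = 0
    · have hsi : s i = 0 := by simpa [hi] using hs i
      simp [Y, mul_apply, diagonal_apply, hi, hsi]
    · rw [mul_apply, Finset.sum_eq_single ⟨i, hi⟩]
      · rcases eq_or_ne i j with rfl | hij
        · simp [Y, hs]
        · simp [Y, hij, hij.symm]
      · rintro ⟨k, hk⟩ _ hki
        have hik : i ≠ k := fun h => hki (Subtype.ext h.symm)
        simp [Y, hik]
      · simp
  refine ⟨Y * E, ?_⟩
  rw [transpose_mul, Matrix.mul_assoc, ← Matrix.mul_assoc E, hE, Matrix.one_mul, hY]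

/-- Let `S ∈ M_p(ℂ)` be symmetric.  Then `S` factors as `S = X Xᵀ`
with `X ∈ M_{p×q}(ℂ)` if and only if `rank S ≤ q`. -/
theorem statement18 (p q : ℕ) (S : Matrix (Fin p) (Fin p) ℂ) (hS : Sᵀ = S) :
    (∃ X : Matrix (Fin p) (Fin q) ℂ, S = X * Xᵀ) ↔ S.rank ≤ q := by
  constructor
  · rintro ⟨X, rfl⟩
    exact (rank_mul_le_left X Xᵀ).trans (rank_le_width X)
  · intro h
    obtain ⟨P, d, hP, rfl⟩ := S.exists_eq_mul_diagonal_mul_transpose hS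
    rw [rank_mul_eq_left_of_isUnit_det _ _ (by rwa [det_transpose]),
      rank_mul_eq_right_of_isUnit_det _ _ hP] at h
    obtain ⟨Z, hZ⟩ := exists_diagonal_eq_mul_transpose (m := Fin q) d (by simpa using h)
    exact ⟨P * Z, by rw [hZ, transpose_mul]; simp only [Matrix.mul_assoc]⟩
end

section
/- Let p, l be natural numbers and let S ∈ M_p(ℂ) be a skew-symmetric matrix (Sᵀ = −S). Then there exist X ∈ M_{p×l}(ℂ) and a skew-symmetric Z ∈ M_l(ℂ) (Zᵀ = −Z) with S = X Z Xᵀ if and only if rank(S) ≤ l. -/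
open Matrix

/-- If `S` has rank at most `card n`, then some product `X * Y` through `n` acts as the identity on
the column space of `S`. -/
theorem Matrix.exists_mul_mul_eq_self_of_rank_le {K m n o : Type*} [Field K] [Fintype m]
    [Fintype n] [Fintype o] (S : Matrix m o K) (h : S.rank ≤ Fintype.card n) :
    ∃ (X : Matrix m n K) (Y : Matrix n m K), X * Y * S = S := by
  classical
  set V := LinearMap.range S.mulVecLin
  have hV : Module.finrank K V ≤ Module.finrank K (n → K) := by
    rwa [Module.finrank_fintype_fun_eq_card]
  obtain ⟨i, hi⟩ : ∃ i : V →ₗ[K] (n → K), Function.Injective i :=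
    finrank_le_iff_exists_linearMap.1 hV
  obtain ⟨g, hg⟩ := i.exists_leftInverse_of_injective (LinearMap.ker_eq_bot.2 hi)
  obtain ⟨q, hq⟩ := V.subtype.exists_leftInverse_of_injective V.ker_subtype
  refine ⟨LinearMap.toMatrix' (V.subtype ∘ₗ g), LinearMap.toMatrix' (i ∘ₗ q),
    Matrix.toLin'.injective (LinearMap.ext fun v ↦ ?_)⟩
  have hqv := LinearMap.congr_fun hq ⟨S *ᵥ v, LinearMap.mem_range_self S.mulVecLin v⟩
  have hgv := LinearMap.congr_fun hg ⟨S *ᵥ v, LinearMap.mem_range_self S.mulVecLin v⟩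
  simp only [LinearMap.comp_apply, Submodule.subtype_apply, LinearMap.id_apply] at hqv hgv
  simp [Matrix.toLin'_mul, hqv, hgv]

/-- Let `S ∈ M_p(ℂ)` be skew-symmetric.  Then `S` factors as
`S = X Z Xᵀ` with `X ∈ M_{p×l}(ℂ)` and `Z ∈ M_l(ℂ)` skew-symmetric if and only if
`rank S ≤ l`. -/
theorem statement19 (p l : ℕ) (S : Matrix (Fin p) (Fin p) ℂ) (hS : Sᵀ = -S) :
    (∃ (X : Matrix (Fin p) (Fin l) ℂ) (Z : Matrix (Fin l) (Fin l) ℂ),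
        Zᵀ = -Z ∧ S = X * Z * Xᵀ) ↔ S.rank ≤ l := by
  constructor
  · rintro ⟨X, Z, -, rfl⟩
    rw [Matrix.mul_assoc]
    exact (rank_mul_le_left X _).trans X.rank_le_width
  · intro h
    obtain ⟨X, Y, hXY⟩ := S.exists_mul_mul_eq_self_of_rank_le (n := Fin l) (by simpa using h)
    have hYX : S * (Yᵀ * Xᵀ) = S := by
      simpa [hS] using congrArg transpose hXY
    refine ⟨X, Y * S * Yᵀ, by simp [hS, Matrix.mul_assoc], ?_⟩
    calc S = X * Y * S * (Yᵀ * Xᵀ) := by rw [hXY, hYX]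
      _ = X * (Y * S * Yᵀ) * Xᵀ := by simp only [Matrix.mul_assoc]
end
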